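/- arXiv:1012.1350 — 7 statements merged into one kernel-verified Lean document; each statement's English description precedes it below -/
import Mathlib

section
/- For all integers r, s ≥ 1 and every k ≥ 1 there exist positive integers n and d such that for every colouring c : ([3])^n → Fin k (i.e. c : (Fin n → Fin 3) → Fin k) there is a block set of degree d with template 1⋯12⋯23 (r ones followed by s twos followed by a single three) on which c is constant. -/
/-- `π` is a rearrangement of the template `τ`: each symbol occurs in `π`
exactly as often as in `τ`. -/
def IsRearrangement {ℓ m : ℕ} (τ π : Fin ℓ → Fin m) : Prop :=
  ∀ j : Fin m,
    (Finset.univ.filter fun i => π i = j).card =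
      (Finset.univ.filter fun i => τ i = j).card

/-- The word `a^π` determined by blocks `I_1, …, I_ℓ`, background letters `a`,
and a rearrangement `π`: its `i`-th letter is `π j` if `i ∈ I j`, and `a i` otherwise. -/
noncomputable def blockWord {ℓ m n : ℕ} (I : Fin ℓ → Finset (Fin n))
    (a : Fin n → Fin m) (π : Fin ℓ → Fin m) : Fin n → Fin m :=
  fun i => if h : ∃ j, i ∈ I j then π h.choose else a i

/-- The colouring `c` is constant on some block set of degree `d` with template `τ`. -/
noncomputable def HasMonoBlockSet {ℓ m n k : ℕ} (τ : Fin ℓ → Fin m) (d : ℕ)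
    (c : (Fin n → Fin m) → Fin k) : Prop :=
  ∃ (I : Fin ℓ → Finset (Fin n)) (a : Fin n → Fin m),
    Pairwise (Function.onFun Disjoint I) ∧ (∑ j, (I j).card) = d ∧
    ∃ col : Fin k, ∀ π : Fin ℓ → Fin m, IsRearrangement τ π →
      c (blockWord I a π) = col

/-- The template `1⋯12⋯23` over `[3]`: `r` ones, then `s` twos, then a single three. -/
def templateRS3 (r s : ℕ) : Fin (r + s + 1) → Fin 3 :=
  fun i => if (i : ℕ) < r then 0 else if (i : ℕ) < r + s then 1 else 2

open Finset in
/-- **Van der Waerden's theorem**, finitary version: the progression lies below a bound depending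
only on its length and the number of colours. -/
theorem exists_mono_arith_progression_lt (s : ℕ) (κ : Type*) [Finite κ] :
    ∃ W D : ℕ, ∀ χ : ℕ → κ, ∃ x g : ℕ, 0 < g ∧ g ≤ D ∧ x + s * g < W ∧
      ∃ col, ∀ t ≤ s, χ (x + t * g) = col := by
  classical
  obtain ⟨ι, _, hι⟩ := Combinatorics.Line.exists_mono_in_high_dimension (Fin (s + 1)) κ
  refine ⟨Fintype.card ι * s + 1, Fintype.card ι, fun χ => ?_⟩
  obtain ⟨l, col, hl⟩ := hι fun v => χ (∑ i, (v i : ℕ))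
  have key : ∀ y : Fin (s + 1), (∑ i, (l y i : ℕ)) =
      (∑ i, (((l.idxFun i).getD 0 : Fin (s + 1)) : ℕ)) + y * #{i | l.idxFun i = none} := by
    intro y
    rw [card_filter, mul_sum, ← sum_add_distrib]
    refine sum_congr rfl fun i _ => ?_
    cases h : l.idxFun i <;> simp [h]
  refine ⟨∑ i, (((l.idxFun i).getD 0 : Fin (s + 1)) : ℕ), #{i | l.idxFun i = none}, ?_, ?_, ?_,
    col, fun t ht => ?_⟩
  · obtain ⟨i, hi⟩ := l.proper
    exact card_pos.2 ⟨i, by simpa using hi⟩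
  · exact card_le_univ _
  · have h := key (Fin.last s)
    rw [Fin.val_last] at h
    rw [← h, Nat.lt_succ_iff]
    calc ∑ i, (l (Fin.last s) i : ℕ) ≤ ∑ _i : ι, s := sum_le_sum fun i _ => by omega
      _ = _ := by simp
  · have h := hl ⟨t, by omega⟩
    simp only [key] at h
    exact h

open Finset in
/-- **Ramsey's theorem** for colourings of the `r`-element subsets of a large finite set. -/
theorem exists_mono_powersetCard (κ : Type*) [Finite κ] [Nonempty κ] (r : ℕ) :
    ∀ m : ℕ, ∃ n : ℕ, ∀ X : Finset ℕ, n ≤ #X → ∀ c : Finset ℕ → κ,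
      ∃ H ⊆ X, #H = m ∧ ∃ col, ∀ S ⊆ H, #S = r → c S = col := by
  classical
  cases nonempty_fintype κ
  induction r with
  | zero =>
    refine fun m => ⟨m, fun X hX c => ?_⟩
    obtain ⟨H, hHX, hH⟩ := exists_subset_card_eq hX
    refine ⟨H, hHX, hH, c ∅, fun S _ hS => ?_⟩
    rw [card_eq_zero.1 hS]
  | succ r ih =>
    have minColoured : ∀ t : ℕ, ∃ n : ℕ, ∀ X : Finset ℕ, n ≤ #X → ∀ c : Finset ℕ → κ,
        ∃ Y ⊆ X, #Y = t ∧ ∃ f : ℕ → κ, ∀ S ⊆ Y, #S = r + 1 →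
          ∀ x ∈ S, (∀ y ∈ S, x ≤ y) → c S = f x := by
      intro t
      induction t with
      | zero =>
        refine ⟨0, fun X _ c => ⟨∅, empty_subset _, rfl, fun _ => c ∅, fun S hS hc => ?_⟩⟩
        simp [subset_empty.1 hS] at hc
      | succ t iht =>
        obtain ⟨n₁, hn₁⟩ := iht
        obtain ⟨n₂, hn₂⟩ := ih n₁
        refine ⟨n₂ + 1, fun X hX c => ?_⟩
        have hne : X.Nonempty := card_pos.1 (by omega)
        set x := X.min' hne with hx
        have hxX : x ∈ X := min'_mem _ _
        obtain ⟨H, hHX, hH, col, hcol⟩ := hn₂ (X.erase x)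
          (by rw [card_erase_of_mem hxX]; omega) (fun S => c (insert x S))
        obtain ⟨Y, hYH, hY, f, hf⟩ := hn₁ H hH.ge c
        have hxY : x ∉ Y := fun h => notMem_erase x X (hHX (hYH h))
        refine ⟨insert x Y, ?_, by rw [card_insert_of_notMem hxY, hY],
          Function.update f x col, fun S hS hSc y hyS hmin => ?_⟩
        · exact insert_subset hxX ((hYH.trans hHX).trans (erase_subset _ _))
        · by_cases hxS : x ∈ S
          · have hSX : S ⊆ X :=
              hS.trans (insert_subset hxX ((hYH.trans hHX).trans (erase_subset _ _)))
            have hyx : y = x := le_antisymm (hmin x hxS) (min'_le _ _ (hSX hyS))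
            rw [hyx, Function.update_self, ← hcol (S.erase x), insert_erase hxS]
            · exact (subset_insert_iff.1 hS).trans hYH
            · rw [card_erase_of_mem hxS, hSc, Nat.add_sub_cancel]
          · have hyx : y ≠ x := fun h => hxS (h ▸ hyS)
            rw [Function.update_of_ne hyx]
            exact hf S ((subset_insert_iff_of_notMem hxS).1 hS) hSc y hyS hmin
    intro m
    obtain ⟨n, hn⟩ := minColoured (Fintype.card κ * m)
    refine ⟨n, fun X hX c => ?_⟩
    obtain ⟨Y, hYX, hY, f, hf⟩ := hn X hX c
    obtain ⟨col, -, hcol⟩ := exists_le_card_fiber_of_mul_le_card_of_maps_to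
      (s := Y) (t := univ) (f := f) (n := m) (fun _ _ => mem_univ _) univ_nonempty
      (by rw [hY, card_univ])
    obtain ⟨H, hH, hHm⟩ := exists_subset_card_eq hcol
    refine ⟨H, hH.trans ((filter_subset _ _).trans hYX), hHm, col, fun S hS hSc => ?_⟩
    have hne : S.Nonempty := card_pos.1 (by omega)
    rw [hf S (hS.trans (hH.trans (filter_subset _ _))) hSc _ (min'_mem S hne)
      fun y hy => min'_le S y hy]
    exact (mem_filter.1 (hH (hS (min'_mem S hne)))).2

open Finset in
/-- **Ramsey's theorem** in terms of a strictly increasing enumeration of the homogeneous set. -/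
theorem exists_strictMonoOn_mono_image (κ : Type*) [Finite κ] [Nonempty κ] (r m : ℕ) :
    ∃ n : ℕ, ∀ c : Finset ℕ → κ, ∃ φ : ℕ → ℕ, StrictMonoOn φ (Set.Iio m) ∧
      (∀ i < m, φ i < n) ∧
      ∃ col, ∀ S ⊆ range m, #S = r → c (S.image φ) = col := by
  obtain ⟨n, hn⟩ := exists_mono_powersetCard κ r m
  refine ⟨n, fun c => ?_⟩
  obtain ⟨H, hHX, hH, col, hcol⟩ := hn (range n) (by simp) c
  have hmem : ∀ i < m, Nat.nth (· ∈ H) i ∈ H := fun i hi =>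
    Nat.nth_mem i fun hf => by
      have : hf.toFinset = H := by ext; simp
      rw [this, hH]; exact hi
  have hmono : StrictMonoOn (Nat.nth (· ∈ H)) (Set.Iio m) := by
    have h := Nat.nth_strictMonoOn (p := (· ∈ H)) H.finite_toSet
    convert h using 2
    rw [← hH]
    congr 1
    ext; simp
  refine ⟨Nat.nth (· ∈ H), hmono, fun i hi => mem_range.1 (hHX (hmem i hi)), col,
    fun S hS hSr => hcol _ ?_ ?_⟩
  · intro x hx
    obtain ⟨i, hi, rfl⟩ := mem_image.1 hx
    exact hmem i (mem_range.1 (hS hi))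
  · rw [card_image_of_injOn, hSr]
    exact hmono.injOn.mono fun i hi => mem_range.1 (hS hi)

/-- Counting over consecutive blocks of length `g`. -/
theorem Nat.count_div_mul_add (P : ℕ → Prop) [DecidablePred P] {g : ℕ} (hg : 0 < g) (m q : ℕ)
    (hq : q ≤ g) :
    Nat.count (fun e => P (e / g)) (m * g + q) = g * Nat.count P m + if P m then q else 0 := by
  have block : ∀ m q, q ≤ g →
      Nat.count (fun k => P ((m * g + k) / g)) q = if P m then q else 0 := by
    intro m q hq
    have h : ∀ k < q, (m * g + k) / g = m := fun k hk => by
      rw [mul_comm, Nat.mul_add_div hg, Nat.div_eq_of_lt (by omega), add_zero]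
    split_ifs with hP
    · exact Nat.count_of_forall fun k hk => by rwa [h k hk]
    · exact Nat.count_of_forall_not fun k hk => by rwa [h k hk]
  induction m generalizing q with
  | zero => simpa using block 0 q hq
  | succ m ih =>
    rw [Nat.count_add, block _ _ hq, Nat.succ_mul, ih g le_rfl, Nat.count_succ]
    split_ifs <;> ring

/-- Counting a predicate that is periodic with period `l`. -/
theorem Nat.count_mod_mul_add (P : ℕ → Prop) [DecidablePred P] (l p j : ℕ) (hj : j ≤ l) :
    Nat.count (fun e => P (e % l)) (p * l + j) = p * Nat.count P l + Nat.count P j := by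
  have block : ∀ p j, j ≤ l →
      Nat.count (fun k => P ((p * l + k) % l)) j = Nat.count P j := by
    intro p j hj
    rw [Nat.count_eq_card_filter_range, Nat.count_eq_card_filter_range]
    congr 1
    refine Finset.filter_congr fun k hk => ?_
    have hk := Finset.mem_range.1 hk
    rw [mul_comm, Nat.mul_add_mod, Nat.mod_eq_of_lt (by omega)]
  induction p generalizing j with
  | zero => simpa using block 0 j hj
  | succ p ih =>
    rw [Nat.count_add, block _ _ hj, Nat.succ_mul, ih l le_rfl]
    ring

/-- The word whose letters outside `S` are `0`, and whose letters inside `S` are `2` or `1`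
according to whether the rank of the coordinate in `S` belongs to `A`. -/
def patternWord (S A : Finset ℕ) (v : ℕ) : Fin 3 :=
  if v ∈ S then if (S.filter (· < v)).card ∈ A then 2 else 1 else 0

open Finset in
theorem patternWord_image {φ : ℕ → ℕ} {m : ℕ} (hφ : StrictMonoOn φ (Set.Iio m)) {S : Finset ℕ}
    (hS : S ⊆ range m) (A : Finset ℕ) {v : ℕ} (hv : v < m) :
    patternWord (S.image φ) A (φ v) = patternWord S A v := by
  have hlt : ∀ u ∈ S, u < m := fun u hu => mem_range.1 (hS hu)
  have hmem : φ v ∈ S.image φ ↔ v ∈ S := by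
    refine ⟨fun h => ?_, mem_image_of_mem φ⟩
    obtain ⟨u, hu, huv⟩ := mem_image.1 h
    rwa [← hφ.injOn (hlt u hu) hv huv]
  have hrank : ((S.image φ).filter (· < φ v)).card = (S.filter (· < v)).card := by
    rw [filter_image, card_image_of_injOn]
    · congr 1
      exact filter_congr fun u hu => hφ.lt_iff_lt (hlt u hu) hv
    · exact hφ.injOn.mono fun u hu => hlt u (mem_filter.1 hu).1
  simp only [patternWord, hmem, hrank]

open Finset in
/-- On a suitable large set of coordinates, the colour of a word depends only on the pattern formed
by its letters `1` and `2`. -/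
theorem exists_pattern_coloring (L m k : ℕ) (hk : 1 ≤ k) :
    ∃ n : ℕ, 0 < n ∧ ∀ c : (Fin n → Fin 3) → Fin k, ∃ φ : ℕ → ℕ, StrictMonoOn φ (Set.Iio m) ∧
      (∀ i < m, φ i < n) ∧ ∃ χ : Finset ℕ → Fin k, ∀ S ⊆ range m, #S = L → ∀ A ⊆ range L,
        c (fun i => patternWord (S.image φ) A i) = χ A := by
  classical
  have : Nonempty (Fin k) := ⟨⟨0, hk⟩⟩
  obtain ⟨n, hn⟩ := exists_strictMonoOn_mono_image ((range L).powerset → Fin k) L m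
  refine ⟨n + 1, n.succ_pos, fun c => ?_⟩
  obtain ⟨φ, hφ, hφn, col, hcol⟩ := hn fun U A => c fun i => patternWord U A i
  refine ⟨φ, hφ, fun i hi => (hφn i hi).trans n.lt_succ_self,
    fun A => if h : A ∈ (range L).powerset then col ⟨A, h⟩ else ⟨0, hk⟩, fun S hS hSL A hA => ?_⟩
  simp only [dif_pos (mem_powerset.2 hA), ← hcol S hS hSL]

open Finset in
/-- Deleting from `range m` the places of the letters `0` of `ρ`, placed along `σ`, lowers ranks by
the number of preceding letters `0`. -/
theorem card_filter_lt_sdiff_image {σ : ℕ → ℕ} {K m : ℕ} (hσ : StrictMonoOn σ (Set.Iio K))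
    (hσm : ∀ e < K, σ e < m) (ρ : ℕ → Fin 3) {e : ℕ} (he : e < K) :
    #{u ∈ range m \ ({e ∈ range K | ρ e = 0} : Finset ℕ).image σ | u < σ e} =
      σ e - Nat.count (ρ · = 0) e := by
  have h : ({u ∈ range m \ ({e ∈ range K | ρ e = 0} : Finset ℕ).image σ | u < σ e} : Finset ℕ) =
      range (σ e) \ ({e' ∈ range e | ρ e' = 0} : Finset ℕ).image σ := by
    ext u
    simp only [mem_filter, mem_sdiff, mem_range, mem_image, not_exists, not_and, and_imp]
    constructor
    · rintro ⟨⟨-, h⟩, hu⟩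
      exact ⟨hu, fun e' he' => h e' (he'.trans he)⟩
    · rintro ⟨hu, h⟩
      refine ⟨⟨hu.trans (hσm e he), fun e' he' h0 heq => ?_⟩, hu⟩
      exact h e' ((hσ.lt_iff_lt he' he).1 (heq ▸ hu)) h0 heq
  rw [h, card_sdiff_of_subset, card_range, card_image_of_injOn, Nat.count_eq_card_filter_range]
  · refine hσ.injOn.mono fun e' he' => ?_
    exact (mem_range.1 (mem_filter.1 he').1).trans he
  · intro u hu
    obtain ⟨e', he', rfl⟩ := mem_image.1 hu
    have hlt := mem_range.1 (mem_filter.1 he').1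
    exact mem_range.2 (hσ (hlt.trans he) he hlt)

open Finset in
/-- Placing the letters `ρ` along `σ`, over a background of letters `1`, gives a pattern word. -/
theorem patternWord_sdiff_image {σ : ℕ → ℕ} {K m : ℕ} (hσ : StrictMonoOn σ (Set.Iio K))
    (hσm : ∀ e < K, σ e < m) (ρ : ℕ → Fin 3) {S A : Finset ℕ}
    (hS : S = range m \ ({e ∈ range K | ρ e = 0} : Finset ℕ).image σ)
    (hA : A = ({e ∈ range K | ρ e = 2} : Finset ℕ).image fun e => σ e - Nat.count (ρ · = 0) e) :
    (∀ e < K, patternWord S A (σ e) = ρ e) ∧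
      ∀ v < m, (∀ e < K, σ e ≠ v) → patternWord S A v = 1 := by
  have hmem : ∀ e < K, σ e ∈ S ↔ ρ e ≠ 0 := by
    intro e he
    simp only [hS, mem_sdiff, mem_range, mem_image, mem_filter, not_exists, not_and, and_imp]
    refine ⟨fun h h0 => h.2 e he h0 rfl, fun h => ⟨hσm e he, fun e' he' h0 heq => ?_⟩⟩
    exact h (hσ.injOn he' he heq ▸ h0)
  have hrank : ∀ v ∈ S, #{u ∈ S | u < v} ∈ A ↔ ∃ e < K, ρ e = 2 ∧ σ e = v := by
    intro v hv
    rw [hA, mem_image]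
    simp only [mem_filter, mem_range]
    constructor
    · rintro ⟨e, ⟨he, h2⟩, heq⟩
      refine ⟨e, he, h2, ?_⟩
      have heS : σ e ∈ S := (hmem e he).2 (by rw [h2]; decide)
      rw [← card_filter_lt_sdiff_image hσ hσm ρ he, ← hS] at heq
      have hstrict : ∀ u ∈ S, ∀ w, u < w → #{z ∈ S | z < u} < #{z ∈ S | z < w} := by
        intro u hu w huw
        refine card_lt_card ⟨fun z hz => ?_, fun h => ?_⟩
        · rw [mem_filter] at hz ⊢
          exact ⟨hz.1, hz.2.trans huw⟩
        · exact lt_irrefl u (mem_filter.1 (h (mem_filter.2 ⟨hu, huw⟩))).2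
      rcases lt_trichotomy (σ e) v with h | h | h
      · exact absurd heq (hstrict _ heS _ h).ne
      · exact h
      · exact absurd heq (hstrict _ hv _ h).ne'
    · rintro ⟨e, he, h2, rfl⟩
      refine ⟨e, ⟨he, h2⟩, ?_⟩
      rw [hS, card_filter_lt_sdiff_image hσ hσm ρ he]
  constructor
  · intro e he
    unfold patternWord
    by_cases h0 : ρ e = 0
    · rw [if_neg (by rw [hmem e he]; exact not_not.2 h0), h0]
    · have heS := (hmem e he).2 h0
      rw [if_pos heS]
      by_cases h2 : ρ e = 2
      · rw [if_pos ((hrank _ heS).2 ⟨e, he, h2, rfl⟩), h2]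
      · rw [if_neg]
        · generalize ρ e = a at h0 h2
          fin_cases a <;> simp_all
        · rw [hrank _ heS]
          rintro ⟨e', he', h2', heq⟩
          exact h2 (hσ.injOn he' he heq ▸ h2')
  · intro v hv hne
    have hvS : v ∈ S := by
      simp only [hS, mem_sdiff, mem_range, mem_image, mem_filter, not_exists, not_and, and_imp]
      exact ⟨hv, fun e he _ => hne e he⟩
    unfold patternWord
    rw [if_pos hvS, if_neg]
    rw [hrank v hvS]
    rintro ⟨e, he, -, heq⟩
    exact hne e he heq

/-- The place of the `e`-th element of the blocks: consecutive runs of `g` elements belong to the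
blocks `0, …, l - 1` in turn, `h` governs the coarse position and `x` the fine one. -/
def slot (r l g W x : ℕ) (h : ℕ → ℕ) (e : ℕ) : ℕ :=
  h e * W + x + (e / g / l * r + e / g % l) * g

theorem slot_strictMonoOn {r s g W x K : ℕ} {h : ℕ → ℕ} (hh : StrictMonoOn h (Set.Iio K))
    (hW : s * g < W) : StrictMonoOn (slot r (r + s + 1) g W x h) (Set.Iio K) := by
  intro e he e' he' hlt
  have h1 : h e + 1 ≤ h e' := hh he he' hlt
  have hm : e / g ≤ e' / g := Nat.div_le_div_right hlt.le
  unfold slot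
  generalize e / g = m at *
  generalize e' / g = m' at *
  have hp : m / (r + s + 1) ≤ m' / (r + s + 1) := Nat.div_le_div_right hm
  have hj := Nat.mod_lt m (show 0 < r + s + 1 by omega)
  have e1 := Nat.div_add_mod m (r + s + 1)
  have e2 := Nat.div_add_mod m' (r + s + 1)
  generalize m / (r + s + 1) = p at *
  generalize m' / (r + s + 1) = p' at *
  generalize m % (r + s + 1) = j at *
  generalize m' % (r + s + 1) = j' at *
  have key : p * r + j ≤ p' * r + j' + s := by
    rcases hp.eq_or_lt with rfl | hp
    · omega
    · have := Nat.mul_le_mul_right r (Nat.succ_le_of_lt hp)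
      rw [Nat.succ_mul] at this
      omega
  have h2 := Nat.mul_le_mul_right g key
  have h3 := Nat.mul_le_mul_right W h1
  have h4 : (p' * r + j' + s) * g = (p' * r + j') * g + s * g := by ring
  have h5 : (h e + 1) * W = h e * W + W := by ring
  omega

theorem slot_lt {r s g M W x N : ℕ} {h : ℕ → ℕ} {e : ℕ} (hg : 0 < g)
    (hW : x + s * g < W) (he : e < M * (r + s + 1) * g) (hN : h e < N) :
    slot r (r + s + 1) g W x h e < N * W + r * (M * g) := by
  have hm : e / g < M * (r + s + 1) := (Nat.div_lt_iff_lt_mul hg).2 he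
  unfold slot
  generalize e / g = m at *
  have hp : m / (r + s + 1) < M := (Nat.div_lt_iff_lt_mul (by omega)).2 hm
  have hj := Nat.mod_lt m (show 0 < r + s + 1 by omega)
  generalize m / (r + s + 1) = p at *
  generalize m % (r + s + 1) = j at *
  have key : p * r + j ≤ M * r + s := by
    have := Nat.mul_le_mul_right r (Nat.succ_le_of_lt hp)
    rw [Nat.succ_mul] at this
    omega
  have h2 := Nat.mul_le_mul_right g key
  have h3 := Nat.mul_le_mul_right W (Nat.succ_le_of_lt hN)
  have h4 : (M * r + s) * g = r * (M * g) + s * g := by ring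
  have h5 : (h e + 1) * W = h e * W + W := by ring
  rw [Nat.succ_eq_add_one] at h3
  omega

open Finset in
theorem card_filter_univ_fin_eq_count (l : ℕ) (ρ : ℕ → Fin 3) (a : Fin 3) :
    #{i : Fin l | ρ i = a} = Nat.count (ρ · = a) l := by
  rw [Nat.count_eq_card_filter_range, card_filter, card_filter,
    Fin.sum_univ_eq_sum_range (fun i => if ρ i = a then 1 else 0)]

open Finset in
theorem card_filter_templateRS3 (r s : ℕ) :
    #{i | templateRS3 r s i = 0} = r ∧ #{i | templateRS3 r s i = 1} = s ∧
      #{i | templateRS3 r s i = 2} = 1 := by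
  let ρ : ℕ → Fin 3 := fun i => if i < r then 0 else if i < r + s then 1 else 2
  have hρ : ∀ a, #{i | templateRS3 r s i = a} = Nat.count (ρ · = a) (r + s + 1) :=
    fun a => card_filter_univ_fin_eq_count _ ρ a
  have h0 : ∀ k < r, ρ k = 0 := fun k hk => by simp [ρ, hk]
  have h1 : ∀ k < s, ρ (r + k) = 1 := fun k hk => by simp [ρ, hk]
  have h2 : ρ (r + s) = 2 := by simp [ρ]
  have hc : ∀ a, Nat.count (ρ · = a) (r + s + 1) =
      (if 0 = a then r else 0) + (if 1 = a then s else 0) + if 2 = a then 1 else 0 := by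
    intro a
    rw [Nat.count_succ, Nat.count_add, h2]
    congr 2
    · split_ifs with h
      · exact Nat.count_of_forall fun k hk => by rw [h0 k hk, h]
      · exact Nat.count_of_forall_not fun k hk => by rwa [h0 k hk]
    · split_ifs with h
      · exact Nat.count_of_forall fun k hk => by rw [h1 k hk, h]
      · exact Nat.count_of_forall_not fun k hk => by rwa [h1 k hk]
  simp [hρ, hc]

theorem Nat.count_fin_three (ρ : ℕ → Fin 3) (n : ℕ) :
    Nat.count (ρ · = 0) n + Nat.count (ρ · = 1) n + Nat.count (ρ · = 2) n = n := by
  induction n with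
  | zero => simp
  | succ n ih =>
    simp only [Nat.count_succ]
    generalize ρ n = a
    fin_cases a <;> simp <;> omega

theorem blockWord_of_mem {l m n : ℕ} {I : Fin l → Finset (Fin n)}
    (hI : Pairwise (Function.onFun Disjoint I)) (a : Fin n → Fin m) (π : Fin l → Fin m)
    {i : Fin n} {j : Fin l} (hij : i ∈ I j) : blockWord I a π i = π j := by
  have h : ∃ j, i ∈ I j := ⟨j, hij⟩
  rw [blockWord, dif_pos h]
  by_contra hne
  have hj : h.choose ≠ j := fun hj => hne (by rw [hj])
  exact Finset.disjoint_left.1 (hI hj) h.choose_spec hij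

/-- In each letter-`2` block of a rearrangement, the fine position after deleting the letters `0`
depends only on the number `t` of letters `1` preceding the letter `2`. -/
theorem exists_slot_sub_count_eq {r s g : ℕ} (hg : 0 < g) (W x : ℕ) (h : ℕ → ℕ) (ρ : ℕ → Fin 3)
    (h0 : Nat.count (ρ · = 0) (r + s + 1) = r) (h1 : Nat.count (ρ · = 1) (r + s + 1) = s)
    (h2 : Nat.count (ρ · = 2) (r + s + 1) = 1) :
    ∃ t ≤ s, ∀ e, ρ (e / g % (r + s + 1)) = 2 →
      slot r (r + s + 1) g W x h e - Nat.count (fun e => ρ (e / g % (r + s + 1)) = 0) e =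
        h e * W + (x + t * g) := by
  have hz : ∀ j < r + s + 1, ρ j = 2 → Nat.count (ρ · = 2) j = 0 := by
    intro j hj hj2
    have := Nat.count_monotone (ρ · = 2) (Nat.succ_le_of_lt hj)
    rw [Nat.succ_eq_add_one, Nat.count_succ, if_pos hj2, h2] at this
    omega
  obtain ⟨j₀, hj₀, hj₀2⟩ := Nat.count_ne_iff_exists.1 (h2.trans_ne one_ne_zero)
  refine ⟨Nat.count (ρ · = 1) j₀, h1 ▸ Nat.count_monotone _ hj₀.le, fun e he => ?_⟩
  have hj := Nat.mod_lt (e / g) (show 0 < r + s + 1 by omega)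
  have hje : e / g % (r + s + 1) = j₀ :=
    Nat.count_injective he hj₀2 ((hz _ hj he).trans (hz _ hj₀ hj₀2).symm)
  have hc : Nat.count (fun e => ρ (e / g % (r + s + 1)) = 0) e =
      (e / g / (r + s + 1) * r + Nat.count (ρ · = 0) j₀) * g := by
    conv_lhs => rw [← Nat.div_add_mod' e g]
    rw [Nat.count_div_mul_add (fun m => ρ (m % (r + s + 1)) = 0) hg _ _ (Nat.mod_lt e hg).le,
      if_neg (by rw [he]; decide), add_zero, mul_comm]
    congr 1
    conv_lhs => rw [← Nat.div_add_mod' (e / g) (r + s + 1)]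
    rw [Nat.count_mod_mul_add (ρ · = 0) _ _ _ hj.le, h0, hje]
  have hsum := Nat.count_fin_three ρ j₀
  rw [hz _ hj₀ hj₀2, add_zero] at hsum
  rw [hc, slot, hje]
  clear hc hje
  generalize Nat.count (ρ · = 0) j₀ = c₀ at *
  generalize Nat.count (ρ · = 1) j₀ = c₁ at *
  rw [← hsum]
  exact Nat.sub_eq_of_eq_add (by ring)

theorem patterns_for_template_one_one_two_two_three (r s k : ℕ)
    (hr : 1 ≤ r) (hs : 1 ≤ s) (hk : 1 ≤ k) :
    ∃ n d : ℕ, 0 < n ∧ 0 < d ∧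
      ∀ c : (Fin n → Fin 3) → Fin k, HasMonoBlockSet (templateRS3 r s) d c := by
  classical
  have hne : Nonempty (Fin k) := ⟨⟨0, hk⟩⟩
  obtain ⟨W, D, hWD⟩ := exists_mono_arith_progression_lt s (Fin k)
  set d := D.factorial
  obtain ⟨N, hN⟩ := exists_strictMonoOn_mono_image (Fin W → Fin k) d (d * (r + s + 1))
  obtain ⟨n, hn, hpat⟩ := exists_pattern_coloring (N * W) (N * W + r * d) k hk
  have hdpos : 0 < d := D.factorial_pos
  refine ⟨n, (r + s + 1) * d, hn, Nat.mul_pos (by omega) hdpos, fun c => ?_⟩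
  obtain ⟨φ, hφ, hφn, χ, hχ⟩ := hpat c
  obtain ⟨h, hh, hhN, col₂, hcol₂⟩ :=
    hN fun P y => χ (P.image fun p => p * W + y)
  obtain ⟨x, g, hg, hgD, hxW, col, hcol⟩ :=
    hWD fun y => if hy : y < W then col₂ ⟨y, hy⟩ else ⟨0, hk⟩
  obtain ⟨M, hM⟩ : g ∣ d := Nat.dvd_factorial hg hgD
  set l := r + s + 1 with hl
  have hlpos : 0 < l := by omega
  have hK : d * l = M * l * g := by rw [hM]; ring
  have hσ : StrictMonoOn (slot r l g W x h) (Set.Iio (d * l)) :=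
    slot_strictMonoOn hh (by omega)
  have hσm : ∀ e < d * l, slot r l g W x h e < N * W + r * d := by
    intro e he
    have := slot_lt (r := r) (M := M) hg hxW (hK ▸ he) (hhN e he)
    rwa [mul_comm M g, ← hM] at this
  have hψ : Set.InjOn (fun e => φ (slot r l g W x h e)) (Set.Iio (d * l)) :=
    fun e he e' he' heq => hσ.injOn he he' (hφ.injOn (hσm e he) (hσm e' he') heq)
  have hcount : ∀ (P : ℕ → Prop) [DecidablePred P],
      Nat.count (fun e => P (e / g % l)) (d * l) = d * Nat.count P l := by
    intro P _
    have hc1 := Nat.count_div_mul_add (fun m => P (m % l)) hg (M * l) 0 (Nat.zero_le _)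
    have hc2 := Nat.count_mod_mul_add P l M 0 (Nat.zero_le _)
    simp only [add_zero, ite_self, Nat.count_zero] at hc1 hc2
    rw [hK, hc1, hc2, hM, mul_assoc]
  let I : Fin l → Finset (Fin n) := fun j => Finset.univ.filter fun i =>
    ∃ e < d * l, e / g % l = j ∧ φ (slot r l g W x h e) = i
  have hI : Pairwise (Function.onFun Disjoint I) := by
    intro j j' hjj
    refine Finset.disjoint_left.2 fun i hi hi' => hjj ?_
    obtain ⟨e, he, hej, hei⟩ := (Finset.mem_filter.1 hi).2
    obtain ⟨e', he', hej', hei'⟩ := (Finset.mem_filter.1 hi').2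
    have : e = e' := hψ he he' (hei.trans hei'.symm)
    exact Fin.ext (by rw [← hej, ← hej', this])
  have hIcard : ∀ j, (I j).card = d := by
    intro j
    have himage : (I j).map Fin.valEmbedding =
        ((Finset.range (d * l)).filter fun e => e / g % l = j).image
          fun e => φ (slot r l g W x h e) := by
      ext v
      simp only [I, Finset.mem_map, Finset.mem_filter, Finset.mem_univ, true_and,
        Finset.mem_image, Finset.mem_range, Fin.valEmbedding_apply]
      constructor
      · rintro ⟨i, ⟨e, he, hej, hei⟩, rfl⟩
        exact ⟨e, ⟨he, hej⟩, hei⟩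
      · rintro ⟨e, ⟨he, hej⟩, rfl⟩
        exact ⟨⟨_, hφn _ (hσm e he)⟩, ⟨e, he, hej, rfl⟩, rfl⟩
    rw [← Finset.card_map Fin.valEmbedding, himage, Finset.card_image_of_injOn,
      ← Nat.count_eq_card_filter_range, hcount (· = (j : ℕ)), Nat.count_eq_card_filter_range,
      Finset.filter_eq' (Finset.range l), if_pos (Finset.mem_range.2 j.2), Finset.card_singleton,
      mul_one]
    exact hψ.mono fun e he => Finset.mem_range.1 (Finset.mem_filter.1 he).1
  refine ⟨I, fun i => if ∃ v < N * W + r * d, φ v = i then 1 else 0, hI, by simp [hIcard],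
    col, fun π hπ => ?_⟩
  obtain ⟨ρ, hρ⟩ : ∃ ρ : ℕ → Fin 3, ∀ j : Fin l, ρ j = π j :=
    ⟨fun j => if hj : j < l then π ⟨j, hj⟩ else 0, fun j => by simp⟩
  have hρc : ∀ a, Nat.count (ρ · = a) l =
      (Finset.univ.filter fun i => templateRS3 r s i = a).card := by
    intro a
    rw [← hπ a, ← card_filter_univ_fin_eq_count]
    simp only [hρ]
    rfl
  obtain ⟨ht0, ht1, ht2⟩ := card_filter_templateRS3 r s
  obtain ⟨t, hts, ht⟩ := exists_slot_sub_count_eq hg W x h ρ ((hρc 0).trans ht0)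
    ((hρc 1).trans ht1) ((hρc 2).trans ht2)
  have hyW : x + t * g < W := (Nat.add_le_add_left (Nat.mul_le_mul_right g hts) x).trans_lt hxW
  set ρ' : ℕ → Fin 3 := fun e => ρ (e / g % l)
  set S := Finset.range (N * W + r * d) \
    ((Finset.range (d * l)).filter fun e => ρ' e = 0).image (slot r l g W x h) with hS
  set Q := (Finset.range (d * l)).filter fun e => ρ' e = 2 with hQ
  have hQrange : Q ⊆ Finset.range (d * l) := Finset.filter_subset _ _
  have hQcard : Q.card = d := by
    rw [hQ, ← Nat.count_eq_card_filter_range, hcount (ρ · = 2), hρc, ht2, mul_one]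
  set A := (Q.image h).image fun p => p * W + (x + t * g) with hA
  have hAeq : A = Q.image fun e => slot r l g W x h e - Nat.count (ρ' · = 0) e := by
    rw [hA, Finset.image_image]
    exact Finset.image_congr fun e he => (ht e (Finset.mem_filter.1 he).2).symm
  have hArange : A ⊆ Finset.range (N * W) := by
    intro v hv
    obtain ⟨p, hp, rfl⟩ := Finset.mem_image.1 hv
    obtain ⟨e, he, rfl⟩ := Finset.mem_image.1 hp
    have h3 := Nat.mul_le_mul_right W
      (Nat.succ_le_of_lt (hhN e (Finset.mem_range.1 (hQrange he))))
    rw [Nat.succ_mul] at h3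
    exact Finset.mem_range.2 (by omega)
  have hScard : S.card = N * W := by
    rw [hS, Finset.card_sdiff_of_subset, Finset.card_range, Finset.card_image_of_injOn,
      ← Nat.count_eq_card_filter_range, hcount (ρ · = 0), hρc, ht0, mul_comm r d,
      Nat.add_sub_cancel]
    · exact hσ.injOn.mono fun e he => Finset.mem_range.1 (Finset.mem_filter.1 he).1
    · intro v hv
      obtain ⟨e, he, rfl⟩ := Finset.mem_image.1 hv
      exact Finset.mem_range.2 (hσm e (Finset.mem_range.1 (Finset.mem_filter.1 he).1))
  have hSrange : S ⊆ Finset.range (N * W + r * d) := Finset.sdiff_subset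
  obtain ⟨hword, hbg⟩ := patternWord_sdiff_image hσ hσm ρ' hS hAeq
  have hblock : blockWord I (fun i => if ∃ v < N * W + r * d, φ v = i then 1 else 0) π =
      fun i : Fin n => patternWord (S.image φ) A i := by
    funext i
    by_cases hi : ∃ v < N * W + r * d, φ v = i
    · obtain ⟨v, hv, hvi⟩ := hi
      rw [← hvi, patternWord_image hφ hSrange A hv]
      by_cases hslot : ∃ e < d * l, slot r l g W x h e = v
      · obtain ⟨e, he, rfl⟩ := hslot
        have hmem : i ∈ I ⟨e / g % l, Nat.mod_lt _ hlpos⟩ :=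
          Finset.mem_filter.2 ⟨Finset.mem_univ _, e, he, rfl, hvi⟩
        rw [blockWord_of_mem hI _ _ hmem, hword e he, ← hρ]
      · push Not at hslot
        rw [hbg v hv hslot, blockWord, dif_neg, if_pos ⟨v, hv, hvi⟩]
        rintro ⟨j, hj⟩
        obtain ⟨e, he, -, hei⟩ := (Finset.mem_filter.1 hj).2
        exact hslot e he (hφ.injOn (hσm e he) hv (hei.trans hvi.symm))
    · rw [blockWord, dif_neg, if_neg hi, patternWord, if_neg]
      · intro hmem
        obtain ⟨v, hv, hvi⟩ := Finset.mem_image.1 hmem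
        exact hi ⟨v, Finset.mem_range.1 (hSrange hv), hvi⟩
      · rintro ⟨j, hj⟩
        obtain ⟨e, he, -, hei⟩ := (Finset.mem_filter.1 hj).2
        exact hi ⟨_, hσm e he, hei⟩
  rw [hblock, hχ S hSrange hScard A hArange, ← hcol t hts, dif_pos hyW, ← hcol₂ Q hQrange hQcard]
end

section
/- For all integers r, s ≥ 1 and every k ≥ 1 there exist positive integers n and d such that for every colouring c : ([2])^n → Fin k (i.e. c : (Fin n → Fin 2) → Fin k) there is a block set of degree d with template 1⋯12⋯2 (r ones followed by s twos) on which c is constant. -/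
/-- The template `1⋯12⋯2` over `[2]`: `r` ones followed by `s` twos. -/
def templateRS2 (r s : ℕ) : Fin (r + s) → Fin 2 :=
  fun i => if (i : ℕ) < r then 0 else 1

/-- **Ramsey's theorem** for `s`-uniform hypergraphs and `k` colours. -/
theorem exists_forall_ramsey (k s m : ℕ) :
    ∃ N : ℕ, ∀ V : Finset ℕ, N ≤ V.card → ∀ c : Finset ℕ → Fin k,
      ∃ T ⊆ V, T.card = m ∧ ∃ col, ∀ A ⊆ T, A.card = s → c A = col := by
  induction s generalizing m with
  | zero =>
    refine ⟨m, fun V hV c => ?_⟩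
    obtain ⟨T, hTV, hT⟩ := Finset.exists_subset_card_eq hV
    refine ⟨T, hTV, hT, c ∅, fun A _ hA => ?_⟩
    rw [Finset.card_eq_zero.mp hA]
  | succ s ih =>
    have end_homogeneous : ∀ t : ℕ, ∃ N : ℕ, ∀ V : Finset ℕ, N ≤ V.card →
        ∀ c : Finset ℕ → Fin k, ∃ T ⊆ V, T.card = t ∧ ∃ f : ℕ → Fin k,
          ∀ x ∈ T, ∀ A ⊆ T, (∀ y ∈ A, x < y) → A.card = s → c (insert x A) = f x := by
      intro t
      induction t with
      | zero =>
        exact ⟨0, fun V _ c => ⟨∅, by simp, rfl, fun _ => c ∅, by simp⟩⟩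
      | succ t iht =>
        obtain ⟨M, hM⟩ := iht
        obtain ⟨N, hN⟩ := ih M
        refine ⟨N + 1, fun V hV c => ?_⟩
        have hne : V.Nonempty := Finset.card_pos.mp (by omega)
        set x := V.min' hne
        have hxV : x ∈ V := V.min'_mem hne
        obtain ⟨U, hUV, hU, col, hcol⟩ := hN (V.erase x)
          (by rw [Finset.card_erase_of_mem hxV]; omega) (fun A => c (insert x A))
        obtain ⟨T, hTU, hT, f, hf⟩ := hM U hU.ge c
        have hlt : ∀ y ∈ T, x < y := fun y hy =>
          V.min'_lt_of_mem_erase_min' hne (hUV (hTU hy))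
        have hxT : x ∉ T := fun h => lt_irrefl _ (hlt x h)
        refine ⟨insert x T, Finset.insert_subset hxV
          ((hTU.trans hUV).trans (Finset.erase_subset _ _)),
          by rw [Finset.card_insert_of_notMem hxT, hT], Function.update f x col, ?_⟩
        intro z hz A hA hzA hAs
        have hxz : x ≤ z := by
          rcases Finset.mem_insert.mp hz with rfl | hz
          exacts [le_rfl, (hlt z hz).le]
        have hAT : A ⊆ T :=
          (Finset.subset_insert_iff_of_notMem fun h => (hzA x h).not_ge hxz).mp hA
        rcases Finset.mem_insert.mp hz with rfl | hzT
        · rw [Function.update_self]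
          exact hcol A (hAT.trans hTU) hAs
        · rw [Function.update_of_ne (hlt z hzT).ne']
          exact hf z hzT A hAT hzA hAs
    obtain ⟨N, hN⟩ := end_homogeneous (k * m)
    refine ⟨N, fun V hV c => ?_⟩
    obtain ⟨T, hTV, hT, f, hf⟩ := hN V hV c
    have : Nonempty (Fin k) := ⟨c ∅⟩
    obtain ⟨col, -, hcol⟩ := Finset.exists_le_card_fiber_of_mul_le_card_of_maps_to
      (s := T) (t := Finset.univ) (f := f) (n := m) (fun _ _ => Finset.mem_univ _)
      Finset.univ_nonempty (by simp [hT])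
    obtain ⟨S, hST, hS⟩ := Finset.exists_subset_card_eq hcol
    have hSsub : S ⊆ T := hST.trans (Finset.filter_subset _ _)
    refine ⟨S, hSsub.trans hTV, hS, col, fun A hA hAs => ?_⟩
    have hne : A.Nonempty := Finset.card_pos.mp (by omega)
    have hmem := A.min'_mem hne
    rw [← Finset.insert_erase hmem, hf _ (hSsub (hA hmem)) _
      ((Finset.erase_subset _ _).trans (hA.trans hSsub))
      (fun y hy => A.min'_lt_of_mem_erase_min' hne hy)
      (by rw [Finset.card_erase_of_mem hmem]; omega)]
    exact (Finset.mem_filter.mp (hST (hA hmem))).2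

theorem card_filter_templateRS2_eq_one (r s : ℕ) :
    (Finset.univ.filter fun i => templateRS2 r s i = 1).card = s := by
  rw [Finset.card_filter]
  simp [templateRS2, Fin.sum_univ_add, -Finset.sum_boole]

theorem blockWord_singleton {ℓ m n : ℕ} {e : Fin ℓ → Fin n} (he : Function.Injective e)
    (a : Fin n → Fin m) (π : Fin ℓ → Fin m) :
    blockWord (fun j => {e j}) a π = Function.extend e π a := by
  funext i
  by_cases h : ∃ j, e j = i
  · obtain ⟨j, rfl⟩ := h
    have hj : ∃ j', e j ∈ ({e j'} : Finset (Fin n)) := ⟨j, Finset.mem_singleton_self _⟩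
    rw [blockWord, dif_pos hj, he.extend_apply,
      ← he (Finset.mem_singleton.mp hj.choose_spec)]
  · rw [Function.extend_apply' _ _ _ h, blockWord, dif_neg]
    rintro ⟨j, hj⟩
    exact h ⟨j, (Finset.mem_singleton.mp hj).symm⟩

/-- Conjecture 5 (Patterns) holds for `m = 2` and all templates `1⋯12⋯2`. -/
theorem patterns_for_two_letter_templates (r s k : ℕ)
    (hr : 1 ≤ r) (hs : 1 ≤ s) (hk : 1 ≤ k) :
    ∃ n d : ℕ, 0 < n ∧ 0 < d ∧
      ∀ c : (Fin n → Fin 2) → Fin k, HasMonoBlockSet (templateRS2 r s) d c := by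
  obtain ⟨N, hN⟩ := exists_forall_ramsey k s (r + s)
  refine ⟨N + 1, r + s, by omega, by omega, fun c => ?_⟩
  obtain ⟨T, hTV, hT, col, hcol⟩ := hN (Finset.range (N + 1)) (by simp)
    (fun A => c fun i => if (i : ℕ) ∈ A then 1 else 0)
  have hlt (j : Fin (r + s)) : T.orderEmbOfFin hT j < N + 1 :=
    Finset.mem_range.mp (hTV (T.orderEmbOfFin_mem hT j))
  let e : Fin (r + s) → Fin (N + 1) := fun j => ⟨T.orderEmbOfFin hT j, hlt j⟩
  have he : Function.Injective e := fun i j hij =>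
    (T.orderEmbOfFin hT).injective (Fin.mk.inj hij)
  refine ⟨fun j => {e j}, fun _ => 0, ?_, by simp, col, fun π hπ => ?_⟩
  · intro i j hij
    simpa [Function.onFun] using he.ne hij
  · rw [blockWord_singleton he]
    let A := (Finset.univ.filter fun j => π j = 1).map (T.orderEmbOfFin hT).toEmbedding
    have hA : A ⊆ T := by
      intro x hx
      obtain ⟨j, -, rfl⟩ := Finset.mem_map.mp hx
      exact T.orderEmbOfFin_mem hT j
    have hAs : A.card = s := by
      rw [Finset.card_map, hπ 1, card_filter_templateRS2_eq_one]
    rw [← hcol A hA hAs]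
    congr 1
    funext i
    by_cases h : ∃ j, e j = i
    · obtain ⟨j, rfl⟩ := h
      have hmem : ((e j : Fin (N + 1)) : ℕ) ∈ A ↔ π j = 1 := by simp [A, e]
      rw [he.extend_apply]
      simp only [hmem]
      split_ifs <;> omega
    · rw [Function.extend_apply' _ _ _ h, if_neg]
      intro hi
      obtain ⟨j, -, hj⟩ := Finset.mem_map.mp hi
      exact h ⟨j, Fin.ext hj⟩
end

section
/- Let α, β, γ be distinct real numbers and let r, s ≥ 1 be integers. Then the set X ⊆ EuclideanSpace ℝ (Fin (r+s+1)) consisting of all points having exactly r coordinates equal to α, exactly s coordinates equal to β, and exactly one coordinate equal to γ is Ramsey. -/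
/-- A set `X ⊆ ℝ^m` is Ramsey if for every `k ≥ 1` there is a dimension `d` such that
every `k`-colouring of `ℝ^d` admits a monochromatic isometric copy of `X`. -/
def IsRamsey {m : ℕ} (X : Set (EuclideanSpace ℝ (Fin m))) : Prop :=
  ∀ k : ℕ, 1 ≤ k → ∃ d : ℕ,
    ∀ c : EuclideanSpace ℝ (Fin d) → Fin k,
      ∃ f : EuclideanSpace ℝ (Fin m) → EuclideanSpace ℝ (Fin d),
        (∀ x ∈ X, ∀ y ∈ X, dist (f x) (f y) = dist x y) ∧
        ∃ col : Fin k, ∀ x ∈ X, c (f x) = col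

/-- Finite Ramsey theorem for `r`-element subsets. -/
theorem exists_homogeneous_finset (κ : Type) [Fintype κ] [DecidableEq κ] (r : ℕ) :
    ∀ m : ℕ, ∃ N : ℕ, ∀ S : Finset ℕ, N ≤ S.card → ∀ C : Finset ℕ → κ,
      ∃ H ⊆ S, H.card = m ∧ ∃ col, ∀ A ⊆ H, A.card = r → C A = col := by
  induction r with
  | zero =>
    intro m
    refine ⟨m, fun S hS C => ?_⟩
    obtain ⟨H, hHS, hH⟩ := Finset.exists_subset_card_eq hS
    refine ⟨H, hHS, hH, C ∅, fun A _ hA => ?_⟩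
    rw [Finset.card_eq_zero.1 hA]
  | succ r ih =>
    have endHomogeneous : ∀ l : ℕ, ∃ N : ℕ, ∀ S : Finset ℕ, N ≤ S.card → ∀ C : Finset ℕ → κ,
        ∃ P ⊆ S, P.card = l ∧ ∃ φ : ℕ → κ, ∀ a ∈ P, ∀ A ⊆ P, (∀ b ∈ A, a < b) → A.card = r →
          C (insert a A) = φ a := by
      intro l
      induction l with
      | zero =>
        refine ⟨0, fun S _ C => ⟨∅, by simp, by simp, fun _ => C ∅, by simp⟩⟩
      | succ l ihl =>
        obtain ⟨N, hN⟩ := ihl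
        obtain ⟨N', hN'⟩ := ih N
        refine ⟨N' + 1, fun S hS C => ?_⟩
        have hne : S.Nonempty := Finset.card_pos.1 (by omega)
        set a := S.min' hne with ha
        have haS : a ∈ S := S.min'_mem hne
        obtain ⟨H, hHS, hHc, col, hcol⟩ := hN' (S.erase a)
          (by rw [Finset.card_erase_of_mem haS]; omega) (fun A => C (insert a A))
        obtain ⟨P, hPH, hPc, φ, hφ⟩ := hN H hHc.ge C
        have hlt : ∀ b ∈ P, a < b := fun b hb => by
          have h := Finset.mem_erase.1 (hHS (hPH hb))
          exact lt_of_le_of_ne (S.min'_le b h.2) (Ne.symm h.1)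
        have haP : a ∉ P := fun h => lt_irrefl _ (hlt a h)
        refine ⟨insert a P, ?_, by rw [Finset.card_insert_of_notMem haP, hPc],
          fun b => if b = a then col else φ b, ?_⟩
        · intro b hb
          rcases Finset.mem_insert.1 hb with rfl | hb
          · exact haS
          · exact Finset.mem_of_mem_erase (hHS (hPH hb))
        · intro b hb A hA hbA hAc
          have hAP : A ⊆ P := fun x hx => by
            rcases Finset.mem_insert.1 (hA hx) with h | h
            · exfalso
              have h1 := hbA x hx
              rcases Finset.mem_insert.1 hb with h2 | h2
              · omega
              · have := hlt b h2
                omega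
            · exact h
          rcases Finset.mem_insert.1 hb with h | h
          · subst h
            simp only [if_true]
            exact hcol A (hAP.trans hPH) hAc
          · have hba : b ≠ a := fun hEq => haP (hEq ▸ h)
            simp only [if_neg hba]
            exact hφ b h A hAP hbA hAc
    intro m
    obtain ⟨N, hN⟩ := endHomogeneous (Fintype.card κ * m)
    refine ⟨N, fun S hS C => ?_⟩
    obtain ⟨P, hPS, hPc, φ, hφ⟩ := hN S hS C
    by_cases hκ : Nonempty κ
    swap
    · exact (hκ ⟨C ∅⟩).elim
    obtain ⟨col, -, hcol⟩ := Finset.exists_le_card_fiber_of_mul_le_card_of_maps_to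
      (s := P) (t := (Finset.univ : Finset κ)) (f := φ) (n := m) (fun _ _ => Finset.mem_univ _)
      Finset.univ_nonempty (by rw [hPc, Finset.card_univ])
    obtain ⟨H, hH, hHc⟩ := Finset.exists_subset_card_eq hcol
    refine ⟨H, fun x hx => hPS (Finset.mem_filter.1 (hH hx)).1, hHc, col, fun A hA hAc => ?_⟩
    have hne : A.Nonempty := Finset.card_pos.1 (by omega)
    have haA := A.min'_mem hne
    have hmem := Finset.mem_filter.1 (hH (hA haA))
    rw [← hmem.2, ← hφ _ hmem.1 (A.erase (A.min' hne)), Finset.insert_erase haA]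
    · exact fun x hx => (Finset.mem_filter.1 (hH (hA (Finset.mem_of_mem_erase hx)))).1
    · intro b hb
      exact lt_of_le_of_ne (A.min'_le b (Finset.mem_of_mem_erase hb))
        (Finset.ne_of_mem_erase hb).symm
    · rw [Finset.card_erase_of_mem haA]
      omega

/-- A finite set of naturals, enumerated increasingly. -/
theorem exists_increasing_enumeration (H : Finset ℕ) :
    ∃ e : ℕ → ℕ, (∀ i < H.card, e i ∈ H) ∧ ∀ i j, i < j → j < H.card → e i < e j := by
  refine ⟨fun i => if h : i < H.card then H.orderEmbOfFin rfl ⟨i, h⟩ else 0, ?_, ?_⟩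
  · intro i hi
    simp [hi]
  · intro i j hij hj
    have hi : i < H.card := hij.trans hj
    simp [hi, hj, hij]

theorem injOn_range_of_increasing {f : ℕ → ℕ} {T : ℕ} (hf : ∀ x y, x < y → y < T → f x < f y) :
    Set.InjOn f (Finset.range T : Set ℕ) := by
  intro x hx y hy h
  rw [Finset.mem_coe, Finset.mem_range] at hx hy
  rcases lt_trichotomy x y with hlt | rfl | hlt
  · exact absurd h (hf x y hlt hy).ne
  · rfl
  · exact absurd h (hf y x hlt hx).ne'

/-- The position of `i` in the increasing enumeration of `U`. -/
def indexIn (U : Finset ℕ) (i : ℕ) : ℕ := (U.filter (· < i)).card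

theorem indexIn_lt_of_lt {U : Finset ℕ} {i j : ℕ} (hi : i ∈ U) (h : i < j) :
    indexIn U i < indexIn U j := by
  refine Finset.card_lt_card (Finset.ssubset_iff.2 ⟨i, by simp, ?_⟩)
  intro x hx
  rcases Finset.mem_insert.1 hx with rfl | hx
  · simp [hi, h]
  · simp only [Finset.mem_filter] at hx ⊢
    exact ⟨hx.1, hx.2.trans h⟩

theorem indexIn_lt_card {U : Finset ℕ} {i : ℕ} (hi : i ∈ U) : indexIn U i < U.card := by
  refine Finset.card_lt_card (Finset.ssubset_iff.2 ⟨i, by simp, ?_⟩)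
  intro x hx
  rcases Finset.mem_insert.1 hx with rfl | hx
  · exact hi
  · exact (Finset.mem_filter.1 hx).1

theorem indexIn_injOn (U : Finset ℕ) : Set.InjOn (indexIn U) U := by
  intro i hi j hj h
  rcases lt_trichotomy i j with hlt | rfl | hlt
  · exact absurd h (indexIn_lt_of_lt hi hlt).ne
  · rfl
  · exact absurd h (indexIn_lt_of_lt hj hlt).ne'

/-- For colourings of pairs `Γ ⊆ U`, one can pass to a large set of coordinates on which the
colour only depends on the positions of the elements of `Γ` inside `U`. -/
theorem exists_pattern_coloring_s2 (κ : Type) [Fintype κ] [DecidableEq κ] (n m : ℕ) :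
    ∃ N : ℕ, ∀ C : Finset ℕ → Finset ℕ → κ, ∃ e : ℕ → ℕ,
      (∀ i < m, e i < N) ∧ (∀ i j, i < j → j < m → e i < e j) ∧
      ∃ g : Finset ℕ → κ, ∀ U ⊆ Finset.range m, U.card = n → ∀ Γ ⊆ U,
        C (U.image e) (Γ.image e) = g (Γ.image (indexIn U)) := by
  classical
  obtain ⟨N, hN⟩ := exists_homogeneous_finset ((Finset.range n).powerset → κ) n m
  refine ⟨N, fun C => ?_⟩
  obtain ⟨H, hHN, hHc, col, hcol⟩ := hN (Finset.range N) (by simp)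
    (fun U G => C U (U.filter fun i => indexIn U i ∈ G.1))
  obtain ⟨e, heH, he⟩ := exists_increasing_enumeration H
  rw [hHc] at heH he
  have hinj : ∀ i < m, ∀ j < m, e i < e j → i < j := by
    intro i hi j hj h
    by_contra hle
    rcases (not_lt.1 hle).lt_or_eq with h' | h'
    · exact absurd h (he j i h' hi).not_gt
    · subst h'
      exact lt_irrefl _ h
  refine ⟨e, fun i hi => Finset.mem_range.1 (hHN (heH i hi)), he,
    fun G => if h : G ∈ (Finset.range n).powerset then col ⟨G, h⟩ else C ∅ ∅, ?_⟩
  intro U hU hUn Γ hΓ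
  have hUm : ∀ i ∈ U, i < m := fun i hi => Finset.mem_range.1 (hU hi)
  have heinj : Set.InjOn e U :=
    (injOn_range_of_increasing he).mono (Finset.coe_subset.2 hU)
  have hidx : ∀ i ∈ U, indexIn (U.image e) (e i) = indexIn U i := by
    intro i hi
    have : (U.image e).filter (· < e i) = (U.filter (· < i)).image e := by
      ext x
      simp only [Finset.mem_filter, Finset.mem_image]
      constructor
      · rintro ⟨⟨j, hj, rfl⟩, hlt⟩
        exact ⟨j, ⟨hj, hinj j (hUm j hj) i (hUm i hi) hlt⟩, rfl⟩
      · rintro ⟨j, ⟨hj, hlt⟩, rfl⟩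
        exact ⟨⟨j, hj, rfl⟩, he j i hlt (hUm i hi)⟩
    rw [indexIn, this, Finset.card_image_of_injOn, indexIn]
    exact heinj.mono fun x hx => (Finset.mem_filter.1 (Finset.mem_coe.1 hx)).1
  have hG : Γ.image (indexIn U) ∈ (Finset.range n).powerset := by
    rw [Finset.mem_powerset]
    intro x hx
    obtain ⟨i, hi, rfl⟩ := Finset.mem_image.1 hx
    exact Finset.mem_range.2 (hUn ▸ indexIn_lt_card (hΓ hi))
  simp only [dif_pos hG]
  have h := congrFun (hcol (U.image e) (fun x hx => by
    obtain ⟨i, hi, rfl⟩ := Finset.mem_image.1 hx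
    exact heH i (hUm i hi)) (by rw [Finset.card_image_of_injOn heinj, hUn]))
    ⟨Γ.image (indexIn U), hG⟩
  rw [← h]
  congr 1
  ext x
  simp only [Finset.mem_filter, Finset.mem_image]
  constructor
  · rintro ⟨i, hi, rfl⟩
    exact ⟨⟨i, hΓ hi, rfl⟩, i, hi, (hidx i (hΓ hi)).symm⟩
  · rintro ⟨⟨i, hi, rfl⟩, j, hj, hji⟩
    rw [hidx i hi] at hji
    exact ⟨j, hj, congrArg e (indexIn_injOn U (hΓ hj) hi hji)⟩

/-- Van der Waerden's theorem, with a bound on the difference. -/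
theorem exists_bounded_vanDerWaerden (k s : ℕ) :
    ∃ n : ℕ, ∀ χ : ℕ → Fin k, ∃ a l : ℕ, 0 < l ∧ l ≤ n ∧ a + l * s ≤ n * s ∧
      ∃ col, ∀ j ≤ s, χ (a + l * j) = col := by
  classical
  obtain ⟨ι, hι, h⟩ := Combinatorics.Line.exists_mono_in_high_dimension (Fin (s + 1)) (Fin k)
  refine ⟨Fintype.card ι, fun χ => ?_⟩
  obtain ⟨L, col, hcol⟩ := h (fun v => χ (∑ i, (v i : ℕ)))
  set W := Finset.univ.filter fun i => L.idxFun i = none with hW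
  have hsum : ∀ j : Fin (s + 1), ∑ i, (L j i : ℕ) =
      ∑ i ∈ Wᶜ, (L 0 i : ℕ) + W.card * j := by
    intro j
    rw [← Finset.sum_compl_add_sum W]
    congr 1
    · refine Finset.sum_congr rfl fun i hi => ?_
      have hi' : L.idxFun i ≠ none := by simpa [hW] using hi
      obtain ⟨x, hx⟩ := Option.ne_none_iff_exists'.1 hi'
      rw [L.apply_some hx, L.apply_some hx]
    · rw [Finset.sum_congr rfl (g := fun _ => (j : ℕ)), Finset.sum_const, smul_eq_mul]
      intro i hi
      rw [L.apply_none _ _ (by simpa [hW] using hi)]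
  refine ⟨∑ i ∈ Wᶜ, (L 0 i : ℕ), W.card, ?_, Finset.card_le_univ W, ?_, col, ?_⟩
  · obtain ⟨i, hi⟩ := L.proper
    exact Finset.card_pos.2 ⟨i, by simp [hW, hi]⟩
  · have := hsum (Fin.last s)
    rw [Fin.val_last] at this
    rw [← this, ← smul_eq_mul, ← Finset.card_univ]
    exact Finset.sum_le_card_nsmul _ _ _ fun i _ => Nat.lt_succ_iff.1 (Fin.is_lt _)
  · intro j hj
    have := hcol ⟨j, Nat.lt_succ_iff.2 hj⟩
    simpa only [hsum] using this

theorem sum_range_comp_div {R : Type*} [CommSemiring R] (G : ℕ → R) (l w t : ℕ) (ht : t ≤ l) :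
    ∑ ε ∈ Finset.range (w * l + t), G (ε / l) = l * ∑ i ∈ Finset.range w, G i + t * G w := by
  have aux : ∀ u v, v ≤ l → ∑ x ∈ Finset.range v, G ((u * l + x) / l) = v * G u := by
    intro u v hv
    rw [Finset.sum_congr rfl (g := fun _ => G u), Finset.sum_const, Finset.card_range,
      nsmul_eq_mul]
    intro x hx
    have hx' : x < l := (Finset.mem_range.1 hx).trans_le hv
    have hdiv : (u * l + x) / l = u :=
      Nat.div_eq_of_lt_le (by omega) (by rw [Nat.succ_mul]; omega)
    rw [hdiv]
  rw [Finset.sum_range_add, aux w t ht]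
  congr 1
  induction w with
  | zero => simp
  | succ w ih => rw [Nat.succ_mul, Finset.sum_range_add, ih, aux w l le_rfl,
      Finset.sum_range_succ, mul_add]

theorem sum_range_comp_mod {R : Type*} [CommSemiring R] (A : ℕ → R) (M q i : ℕ) (hi : i ≤ M) :
    ∑ w ∈ Finset.range (q * M + i), A (w % M) =
      q * ∑ j ∈ Finset.range M, A j + ∑ j ∈ Finset.range i, A j := by
  have aux : ∀ u v, v ≤ M →
      ∑ x ∈ Finset.range v, A ((u * M + x) % M) = ∑ j ∈ Finset.range v, A j := by
    intro u v hv
    refine Finset.sum_congr rfl fun x hx => ?_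
    rw [mul_comm u M, Nat.mul_add_mod, Nat.mod_eq_of_lt ((Finset.mem_range.1 hx).trans_le hv)]
  rw [Finset.sum_range_add, aux q i hi]
  congr 1
  induction q with
  | zero => simp
  | succ q ih => rw [Nat.succ_mul, Finset.sum_range_add, ih, aux q M le_rfl]; push_cast; ring

/-- The layout `(0^l 1^l ⋯ (M-1)^l)` repeated `z` times takes every value equally often. -/
theorem sum_range_comp_block {R : Type*} [CommSemiring R] (G : ℕ → R) (l M z : ℕ) :
    ∑ ε ∈ Finset.range (M * (z * l)), G (ε / l % M) =
      ((z * l : ℕ) : R) * ∑ i ∈ Finset.range M, G i := by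
  have h := sum_range_comp_div (fun w => G (w % M)) l (z * M) 0 (Nat.zero_le _)
  have h' := sum_range_comp_mod G M z 0 (Nat.zero_le _)
  simp only [add_zero, Nat.cast_zero, zero_mul, Finset.range_zero, Finset.sum_empty] at h h'
  rw [show M * (z * l) = z * M * l by ring, h, h']
  push_cast
  ring

/-- The number of entries of the layout before the `ε`-th one whose block lies in `A`. -/
theorem card_filter_block_lt (l M : ℕ) (hl : 0 < l) (hM : 0 < M) (A : Finset ℕ)
    (hA : A ⊆ Finset.range M) (ε : ℕ) (hε : ε / l % M ∉ A) :
    ((Finset.range ε).filter fun x => x / l % M ∈ A).card =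
      l * (A.card * (ε / l / M) + (A.filter (· < ε / l % M)).card) := by
  classical
  have h := sum_range_comp_div (fun w => if w % M ∈ A then 1 else 0) l (ε / l) (ε % l)
    (Nat.mod_lt _ hl).le
  have h' := sum_range_comp_mod (fun w => if w ∈ A then 1 else 0) M (ε / l / M) (ε / l % M)
    (Nat.mod_lt _ hM).le
  rw [Nat.div_add_mod'] at h h'
  rw [Finset.card_filter, h, h', if_neg hε, ← Finset.card_filter, ← Finset.card_filter]
  have h1 : (Finset.range M).filter (· ∈ A) = A := by
    ext x
    simpa using fun hx => Finset.mem_range.1 (hA hx)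
  have h2 : (Finset.range (ε / l % M)).filter (· ∈ A) = A.filter (· < ε / l % M) := by
    ext x
    simp [and_comm]
  rw [h1, h2]
  simp [mul_comm]

/-- The `ε`-th position of the layout. -/
def layoutPosition (b : ℕ → ℕ) (L a l M r ε : ℕ) : ℕ :=
  L * b ε + a + (r * (ε / l / M) + ε / l % M) * l

theorem offset_lt {L l M r d n T ε : ℕ} (hL : r * d + M * n < L) (hM : 0 < M) (hln : l ≤ n)
    (hT : T = M * d) (hε : ε < T) : (r * (ε / l / M) + ε / l % M) * l < L := by
  subst hT
  have h1 : ε / l / M * l ≤ d := by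
    have : ε / l / M = ε / M / l := Nat.div_right_comm ..
    rw [this]
    refine (Nat.div_mul_le_self _ _).trans ?_
    exact (Nat.div_lt_of_lt_mul hε).le
  have h2 : ε / l % M * l ≤ M * n := Nat.mul_le_mul (Nat.mod_lt _ hM).le hln
  calc (r * (ε / l / M) + ε / l % M) * l = r * (ε / l / M * l) + ε / l % M * l := by ring
    _ ≤ r * d + M * n := by gcongr
    _ < L := hL

/-- Removing the blocks in `A` shifts a position of another block down; the resulting offset no
longer depends on the repetition of the layout that the position belongs to. -/
theorem indexIn_layout {b : ℕ → ℕ} {L a l M T m : ℕ} {A : Finset ℕ} (hl : 0 < l) (hM : 0 < M)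
    (hp : ∀ x y, x < y → y < T →
      layoutPosition b L a l M A.card x < layoutPosition b L a l M A.card y)
    (hpm : ∀ x < T, layoutPosition b L a l M A.card x < m)
    (hA : A ⊆ Finset.range M) {ε : ℕ} (hεT : ε < T) (hε : ε / l % M ∉ A) :
    indexIn (Finset.range m \ ((Finset.range T).filter fun x => x / l % M ∈ A).image
        (layoutPosition b L a l M A.card)) (layoutPosition b L a l M A.card ε) =
      L * b ε + (a + l * (ε / l % M - (A.filter (· < ε / l % M)).card)) := by
  classical
  set p := layoutPosition b L a l M A.card with hpdef
  have hset : (Finset.range m \ ((Finset.range T).filter fun x => x / l % M ∈ A).image p).filter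
      (· < p ε) = Finset.range (p ε) \ ((Finset.range ε).filter fun x => x / l % M ∈ A).image p := by
    ext x
    simp only [Finset.mem_filter, Finset.mem_sdiff, Finset.mem_range, Finset.mem_image, not_exists,
      not_and, and_imp]
    constructor
    · rintro ⟨⟨-, h⟩, hx⟩
      exact ⟨hx, fun y hy => h y (hy.trans hεT)⟩
    · rintro ⟨hx, h⟩
      refine ⟨⟨hx.trans (hpm ε hεT), fun y hy hyA hyx => ?_⟩, hx⟩
      rcases lt_trichotomy y ε with hlt | rfl | hlt
      · exact h y hlt hyA hyx
      · exact hε hyA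
      · exact absurd (hp ε y hlt hy) (by omega)
  have hinj := injOn_range_of_increasing hp
  rw [indexIn, hset, Finset.card_sdiff_of_subset, Finset.card_range, Finset.card_image_of_injOn,
    card_filter_block_lt l M hl hM A hA ε hε]
  · have hle : (A.filter (· < ε / l % M)).card ≤ ε / l % M := by
      refine (Finset.card_le_card (t := Finset.range (ε / l % M)) fun x hx => ?_).trans
        (Finset.card_range _).le
      exact Finset.mem_range.2 (Finset.mem_filter.1 hx).2
    obtain ⟨j, hj⟩ := Nat.exists_eq_add_of_le hle
    have : p ε = l * (A.card * (ε / l / M) + (A.filter (· < ε / l % M)).card) +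
        (L * b ε + (a + l * j)) := by
      simp only [hpdef, layoutPosition]
      generalize (A.filter (· < ε / l % M)).card = c at hj ⊢
      rw [hj]
      ring
    rw [this, Nat.add_sub_cancel_left]
    congr 3
    omega
  · refine hinj.mono fun x hx => ?_
    have := Finset.mem_range.1 (Finset.mem_filter.1 (Finset.mem_coe.1 hx)).1
    exact Finset.mem_coe.2 (Finset.mem_range.2 (this.trans hεT))
  · intro x hx
    obtain ⟨y, hy, rfl⟩ := Finset.mem_image.1 hx
    exact Finset.mem_range.2 (hp y ε (Finset.mem_range.1 (Finset.mem_filter.1 hy).1) hεT)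

/-- The combinatorial core: there are `r + s + 1` blocks of `D` coordinates each inside a set `H`
such that, when `r` blocks `A` are removed from `H` and another block `i` is marked, the colour of
the resulting pair does not depend on the choice of `A` and `i`. -/
theorem exists_monochromatic_layout (k r s : ℕ) :
    ∃ D N : ℕ, 0 < D ∧ ∀ C : Finset ℕ → Finset ℕ → Fin k,
      ∃ (H : Finset ℕ) (P blk : ℕ → ℕ), H ⊆ Finset.range N ∧
        Set.InjOn P (Finset.range ((r + s + 1) * D) : Set ℕ) ∧
        (∀ ε < (r + s + 1) * D, P ε ∈ H) ∧ (∀ ε, blk ε < r + s + 1) ∧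
        (∀ g : ℕ → ℝ, ∑ ε ∈ Finset.range ((r + s + 1) * D), g (blk ε) =
          D * ∑ i ∈ Finset.range (r + s + 1), g i) ∧
        ∃ col, ∀ A ⊆ Finset.range (r + s + 1), A.card = r → ∀ i < r + s + 1, i ∉ A →
          C (H \ ((Finset.range ((r + s + 1) * D)).filter fun ε => blk ε ∈ A).image P)
            (((Finset.range ((r + s + 1) * D)).filter fun ε => blk ε = i).image P) = col := by
  classical
  set M := r + s + 1 with hMdef
  have hM : 0 < M := by omega
  obtain ⟨n, hn⟩ := exists_bounded_vanDerWaerden k s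
  set D := n.factorial with hD
  set V := n * s with hV
  set L := r * D + M * n + 1 with hL
  obtain ⟨N₂, hN₂⟩ := exists_homogeneous_finset (Fin (V + 1) → Fin k) D (M * D)
  set m := L * N₂ + V + 1 with hm
  obtain ⟨N, hN⟩ := exists_pattern_coloring_s2 (Fin k) (m - r * D) m
  refine ⟨D, N, n.factorial_pos, fun C => ?_⟩
  obtain ⟨e, heN, he, g, hg⟩ := hN C
  obtain ⟨B, hBN, hBc, χ, hχ⟩ := hN₂ (Finset.range N₂) (by simp)
    (fun X v => g (X.image fun x => L * x + v))
  obtain ⟨a, l, hl, hln, has, col, hcol⟩ := hn fun v => if h : v < V + 1 then χ ⟨v, h⟩ else g ∅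
  obtain ⟨z, hz⟩ := Nat.dvd_factorial hl hln
  rw [← hD, mul_comm] at hz
  obtain ⟨b, hbB, hb⟩ := exists_increasing_enumeration B
  rw [hBc] at hbB hb
  set p := layoutPosition b L a l M r with hp
  have hoff : ∀ x < M * D, (r * (x / l / M) + x / l % M) * l < L := fun x hx =>
    offset_lt (Nat.lt_succ_self _) hM hln rfl hx
  have hpmono : ∀ x y, x < y → y < M * D → p x < p y := by
    intro x y hxy hy
    have h1 := hoff x (hxy.trans hy)
    have h2 : L * (b x + 1) ≤ L * b y := Nat.mul_le_mul_left L (hb x y hxy hy)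
    rw [mul_add, mul_one] at h2
    simp only [hp, layoutPosition]
    omega
  have hpm : ∀ x < M * D, p x < m := by
    intro x hx
    have h1 := hoff x hx
    have h2 : L * (b x + 1) ≤ L * N₂ :=
      Nat.mul_le_mul_left L (Finset.mem_range.1 (hBN (hbB x hx)))
    have h3 : a ≤ V := (Nat.le_add_right _ _).trans has
    rw [mul_add, mul_one] at h2
    simp only [hp, layoutPosition, hm]
    omega
  have hpinj := injOn_range_of_increasing hpmono
  have heinj := injOn_range_of_increasing he
  have hbinj := injOn_range_of_increasing hb
  have hsum : ∀ {R : Type} [CommSemiring R] (G : ℕ → R),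
      ∑ ε ∈ Finset.range (M * D), G (ε / l % M) = (D : R) * ∑ i ∈ Finset.range M, G i := by
    intro R _ G
    rw [hz]
    exact sum_range_comp_block G l M z
  have hfiber : ∀ A ⊆ Finset.range M,
      ((Finset.range (M * D)).filter fun ε => ε / l % M ∈ A).card = D * A.card := by
    intro A hA
    have := hsum fun w => if w ∈ A then 1 else 0
    rw [← Finset.card_filter, ← Finset.card_filter] at this
    rw [this, Finset.filter_mem_eq_inter, Finset.inter_eq_right.2 hA]
    simp
  refine ⟨(Finset.range m).image e, e ∘ p, fun ε => ε / l % M, ?_, ?_, ?_,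
    fun ε => Nat.mod_lt _ hM, fun G => hsum G, col, ?_⟩
  · intro x hx
    obtain ⟨i, hi, rfl⟩ := Finset.mem_image.1 hx
    exact Finset.mem_range.2 (heN i (Finset.mem_range.1 hi))
  · exact heinj.comp hpinj fun x hx =>
      Finset.mem_coe.2 (Finset.mem_range.2 (hpm x (Finset.mem_range.1 (Finset.mem_coe.1 hx))))
  · exact fun ε hε => Finset.mem_image_of_mem e (Finset.mem_range.2 (hpm ε hε))
  intro A hA hAr i hi hiA
  set F := (Finset.range (M * D)).filter fun ε => ε / l % M ∈ A with hF
  set Q := (Finset.range (M * D)).filter fun ε => ε / l % M = i with hQ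
  have hFm : F.image p ⊆ Finset.range m := fun x hx => by
    obtain ⟨y, hy, rfl⟩ := Finset.mem_image.1 hx
    exact Finset.mem_range.2 (hpm y (Finset.mem_range.1 (Finset.mem_filter.1 hy).1))
  have hQU : Q.image p ⊆ Finset.range m \ F.image p := by
    intro x hx
    obtain ⟨y, hy, rfl⟩ := Finset.mem_image.1 hx
    have hy' := Finset.mem_filter.1 hy
    refine Finset.mem_sdiff.2 ⟨Finset.mem_range.2 (hpm y (Finset.mem_range.1 hy'.1)), fun h => ?_⟩
    obtain ⟨w, hw, hwy⟩ := Finset.mem_image.1 h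
    have hw' := Finset.mem_filter.1 hw
    have := hpinj (Finset.mem_coe.2 hw'.1) (Finset.mem_coe.2 hy'.1) hwy
    subst this
    exact hiA (hy'.2 ▸ hw'.2)
  have hUc : (Finset.range m \ F.image p).card = m - r * D := by
    rw [Finset.card_sdiff_of_subset hFm, Finset.card_range,
      Finset.card_image_of_injOn (hpinj.mono (Finset.coe_subset.2 (Finset.filter_subset _ _))),
      hfiber A hA, hAr, mul_comm]
  have hpat := hg _ Finset.sdiff_subset hUc _ hQU
  rw [Finset.image_sdiff_of_injOn heinj hFm, Finset.image_image, Finset.image_image] at hpat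
  rw [hpat]
  set j := i - (A.filter (· < i)).card with hj
  have hjs : j ≤ s := by
    have h1 : (A.filter (· < i)).card + (A.filter fun x => ¬ x < i).card = A.card :=
      Finset.card_filter_add_card_filter_not _
    have h2 : (A.filter fun x => ¬ x < i).card ≤ (Finset.Ioo i M).card := by
      refine Finset.card_le_card fun x hx => ?_
      have hx' := Finset.mem_filter.1 hx
      have hne : x ≠ i := fun h => hiA (h ▸ hx'.1)
      have := Finset.mem_range.1 (hA hx'.1)
      exact Finset.mem_Ioo.2 ⟨by omega, this⟩
    rw [Nat.card_Ioo] at h2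
    omega
  have hv : a + l * j < V + 1 := by
    have := Nat.mul_le_mul_left l hjs
    omega
  have himage : (Q.image p).image (indexIn (Finset.range m \ F.image p)) =
      (Q.image b).image fun x => L * x + (a + l * j) := by
    rw [Finset.image_image, Finset.image_image]
    refine Finset.image_congr fun ε hε => ?_
    have hε' := Finset.mem_filter.1 (Finset.mem_coe.1 hε)
    have hεA : ε / l % M ∉ A := by rwa [hε'.2]
    have := indexIn_layout (m := m) hl hM (by rw [hAr]; exact hpmono) (by rw [hAr]; exact hpm) hA
      (Finset.mem_range.1 hε'.1) hεA
    simp only [hAr, hε'.2] at this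
    exact this
  have hQB : Q.image b ⊆ B := fun x hx => by
    obtain ⟨y, hy, rfl⟩ := Finset.mem_image.1 hx
    exact hbB y (Finset.mem_range.1 (Finset.mem_filter.1 hy).1)
  have hQc : (Q.image b).card = D := by
    rw [Finset.card_image_of_injOn (hbinj.mono (Finset.coe_subset.2 (Finset.filter_subset _ _)))]
    have := hfiber {i} (by simpa using hi)
    simpa using this
  have h1 := congrFun (hχ _ hQB hQc) ⟨a + l * j, hv⟩
  have h2 := hcol j hjs
  simp only [dif_pos hv] at h2
  rw [himage, ← h2, ← h1]

/-- For distinct reals `α`, `β`, `γ`, the set of points of `ℝ^{r+s+1}` having exactly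
`r` coordinates `α`, `s` coordinates `β` and one coordinate `γ` is Ramsey. -/
theorem ramsey_of_three_value_orbit (α β γ : ℝ)
    (hαβ : α ≠ β) (hαγ : α ≠ γ) (hβγ : β ≠ γ) (r s : ℕ) (hr : 1 ≤ r) (hs : 1 ≤ s) :
    IsRamsey {x : EuclideanSpace ℝ (Fin (r + s + 1)) |
      (Finset.univ.filter fun i => x i = α).card = r ∧
      (Finset.univ.filter fun i => x i = β).card = s ∧
      (Finset.univ.filter fun i => x i = γ).card = 1} := by
  classical
  intro k _
  obtain ⟨D, N, hD, hN⟩ := exists_monochromatic_layout k r s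
  refine ⟨N, fun c => ?_⟩
  set t : ℝ := (Real.sqrt D)⁻¹ with ht
  have ht2 : t ^ 2 * D = 1 := by
    have : (0 : ℝ) < D := Nat.cast_pos.2 hD
    rw [ht, inv_pow, Real.sq_sqrt this.le, inv_mul_cancel₀ this.ne']
  obtain ⟨H, P, blk, hHN, hPinj, hPH, hblk, hsum, col, hcol⟩ := hN fun U Γ =>
    c (WithLp.toLp 2 fun i : Fin N =>
      t * if (i : ℕ) ∈ Γ then γ else if (i : ℕ) ∈ U then β else α)
  set M := r + s + 1 with hM
  have hex : ∀ i ∈ (Finset.range (M * D)).image P, ∃ ε ∈ Finset.range (M * D), P ε = i :=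
    fun i hi => Finset.mem_image.1 hi
  choose! ρ hρ hPρ using hex
  have hρP : ∀ ε ∈ Finset.range (M * D), ρ (P ε) = ε := fun ε hε =>
    hPinj (Finset.mem_coe.2 (hρ _ (Finset.mem_image_of_mem P hε))) (Finset.mem_coe.2 hε)
      (hPρ _ (Finset.mem_image_of_mem P hε))
  let v : EuclideanSpace ℝ (Fin M) → ℕ → ℝ := fun x i =>
    if i ∈ (Finset.range (M * D)).image P then x ⟨blk (ρ i), hblk _⟩
    else if i ∈ H then β else α
  refine ⟨fun x => WithLp.toLp 2 fun i : Fin N => t * v x i, ?_, col, ?_⟩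
  · intro x _ y _
    rw [EuclideanSpace.dist_eq, EuclideanSpace.dist_eq]
    congr 1
    let G : ℕ → ℝ := fun i => if h : i < M then dist (x ⟨i, h⟩) (y ⟨i, h⟩) ^ 2 else 0
    have hterm : ∀ i : ℕ, dist (t * v x i) (t * v y i) ^ 2 =
        t ^ 2 * if i ∈ (Finset.range (M * D)).image P then G (blk (ρ i)) else 0 := by
      intro i
      rw [Real.dist_eq, ← mul_sub, abs_mul, mul_pow, sq_abs]
      by_cases hi : i ∈ (Finset.range (M * D)).image P
      · simp only [v, G, if_pos hi, dif_pos (hblk _), Real.dist_eq]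
      · simp only [v, if_neg hi, sub_self, abs_zero]
        norm_num
    have hsub : (Finset.range (M * D)).image P ⊆ Finset.range N := fun i hi => by
      obtain ⟨ε, hε, rfl⟩ := Finset.mem_image.1 hi
      exact hHN (hPH ε (Finset.mem_range.1 hε))
    calc ∑ i : Fin N, dist (t * v x i) (t * v y i) ^ 2
        = ∑ i ∈ Finset.range N, dist (t * v x i) (t * v y i) ^ 2 :=
          Fin.sum_univ_eq_sum_range (fun i => dist (t * v x i) (t * v y i) ^ 2) N
      _ = t ^ 2 * ∑ i ∈ (Finset.range (M * D)).image P, G (blk (ρ i)) := by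
          rw [Finset.sum_congr rfl fun i _ => hterm i, ← Finset.mul_sum, Finset.sum_ite_mem,
            Finset.inter_eq_right.2 hsub]
      _ = t ^ 2 * ∑ ε ∈ Finset.range (M * D), G (blk ε) := by
          rw [Finset.sum_image hPinj]
          exact congrArg _ (Finset.sum_congr rfl fun ε hε => by rw [hρP ε hε])
      _ = ∑ i ∈ Finset.range M, G i := by rw [hsum G, ← mul_assoc, ht2, one_mul]
      _ = ∑ i : Fin M, dist (x i) (y i) ^ 2 := by
          rw [← Fin.sum_univ_eq_sum_range]
          exact Finset.sum_congr rfl fun i _ => by simp only [G, dif_pos i.is_lt]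
  · rintro x ⟨hxα, hxβ, hxγ⟩
    obtain ⟨i₀, hi₀⟩ := Finset.card_eq_one.1 hxγ
    have hγ : ∀ i, x i = γ ↔ i = i₀ := fun i => by
      simpa using congrArg (i ∈ ·) hi₀
    have hval : ∀ i, x i ≠ α → x i ≠ γ → x i = β := by
      have hdisj : Disjoint (Finset.univ.filter fun i => x i = α)
          (Finset.univ.filter fun i => x i = β) :=
        Finset.disjoint_filter.2 fun i _ h h' => hαβ (h.symm.trans h')
      have hdisj' : Disjoint ((Finset.univ.filter fun i => x i = α) ∪
          (Finset.univ.filter fun i => x i = β)) (Finset.univ.filter fun i => x i = γ) :=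
        Finset.disjoint_union_left.2
          ⟨Finset.disjoint_filter.2 fun i _ h h' => hαγ (h.symm.trans h'),
            Finset.disjoint_filter.2 fun i _ h h' => hβγ (h.symm.trans h')⟩
      have huniv := (Finset.card_eq_iff_eq_univ _).1 (show (((Finset.univ.filter fun i => x i = α) ∪
          (Finset.univ.filter fun i => x i = β)) ∪
            (Finset.univ.filter fun i => x i = γ)).card = Fintype.card (Fin M) by
        rw [Finset.card_union_of_disjoint hdisj', Finset.card_union_of_disjoint hdisj, hxα, hxβ,
          hxγ, Fintype.card_fin])
      intro i h1 h2
      have : i ∈ Finset.univ := Finset.mem_univ i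
      rw [← huniv] at this
      simpa [h1, h2] using this
    set A := (Finset.univ.filter fun i => x i = α).image (Fin.val : Fin M → ℕ) with hA
    have hmemA : ∀ i : Fin M, (i : ℕ) ∈ A ↔ x i = α := fun i => by
      simp [hA, Fin.val_inj]
    have hcolour := hcol A
      (fun i hi => by
        obtain ⟨j, -, rfl⟩ := Finset.mem_image.1 hi
        exact Finset.mem_range.2 j.is_lt)
      (by rw [hA, Finset.card_image_of_injective _ Fin.val_injective, hxα]) i₀ i₀.is_lt
      (by rw [hmemA, (hγ i₀).2 rfl]; exact hαγ.symm)
    rw [← hcolour]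
    refine congrArg c (congrArg (WithLp.toLp 2) (funext fun i => congrArg (t * ·) ?_))
    by_cases hi : (i : ℕ) ∈ (Finset.range (M * D)).image P
    · have hPi := hPρ _ hi
      have hρi := hρ _ hi
      have hmem : ∀ (Q : ℕ → Prop) [DecidablePred Q],
          (i : ℕ) ∈ ((Finset.range (M * D)).filter fun ε => Q (blk ε)).image P ↔ Q (blk (ρ i)) := by
        intro Q _
        constructor
        · intro h
          obtain ⟨ε, hε, hεi⟩ := Finset.mem_image.1 h
          rw [← hεi, hρP ε (Finset.mem_filter.1 hε).1]
          exact (Finset.mem_filter.1 hε).2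
        · exact fun h => Finset.mem_image.2 ⟨_, Finset.mem_filter.2 ⟨hρi, h⟩, hPi⟩
      have hiH : (i : ℕ) ∈ H := hPi ▸ hPH _ (Finset.mem_range.1 hρi)
      have h1 := hmem fun j => j = i₀
      have h2 := hmem fun j => j ∈ A
      have h3 := hmemA ⟨blk (ρ i), hblk _⟩
      have h4 := hγ ⟨blk (ρ i), hblk _⟩
      rw [Fin.ext_iff] at h4
      simp only [v, if_pos hi, Finset.mem_sdiff, hiH, true_and, h1, h2]
      split_ifs with h5 h6
      · exact h4.2 h5
      · exact h3.1 h6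
      · exact hval _ (fun h => h6 (h3.2 h)) fun h => h5 (h4.1 h)
    · have hnot : ∀ (Q : ℕ → Prop) [DecidablePred Q],
          (i : ℕ) ∉ ((Finset.range (M * D)).filter fun ε => Q (blk ε)).image P := fun Q _ h =>
        hi (Finset.image_subset_image (Finset.filter_subset _ _) h)
      have h1 := hnot fun j => j = i₀
      have h2 := hnot fun j => j ∈ A
      simp only [v, if_neg hi, Finset.mem_sdiff, h1, h2, if_false, not_false_eq_true, and_true]
end

section
/- For every n ∈ ℕ there exists a countable family 𝒮 of subgroups of the orthogonal group O(n, ℝ) such that every finite subgroup H of O(n, ℝ) is conjugate in O(n, ℝ) to some member of 𝒮. In other words, up to conjugation by elements of O(n, ℝ), the orthogonal group O(n, ℝ) has only countably many finite subgroups. -/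
/-- An invertible real matrix `T` intertwining orthogonal matrices `A i` and `B i` can be replaced
by an orthogonal one, namely the orthogonal factor `T (Tᵀ T)^(-1/2)` of its polar decomposition. -/
theorem exists_orthogonal_intertwiner {ι m : Type*} [Fintype m] [DecidableEq m]
    (A B : ι → Matrix.orthogonalGroup m ℝ) (T : Matrix m m ℝ) (hT : T.det ≠ 0)
    (h : ∀ i, (A i : Matrix m m ℝ) * T = T * (B i : Matrix m m ℝ)) :
    ∃ u : Matrix.orthogonalGroup m ℝ, ∀ i, A i * u = u * B i := by
  have hunit : IsUnit T := (Matrix.isUnit_iff_isUnit_det T).2 hT.isUnit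
  set S : Matrix m m ℝ := star T * T with hS
  have hpos : S.PosDef :=
    Matrix.PosDef.conjTranspose_mul_self T (Matrix.mulVec_injective_of_isUnit hunit)
  have hsa : IsSelfAdjoint S := hpos.1
  have hspec : ∀ x ∈ spectrum ℝ S, 0 < x := by
    intro x hx
    rw [hpos.1.spectrum_real_eq_range_eigenvalues] at hx
    obtain ⟨i, rfl⟩ := hx
    exact hpos.eigenvalues_pos i
  have hfin : (spectrum ℝ S).Finite := by
    rw [hpos.1.spectrum_real_eq_range_eigenvalues]
    exact Set.finite_range _
  have hcont : ∀ f : ℝ → ℝ, ContinuousOn f (spectrum ℝ S) := fun f => hfin.continuousOn f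
  set R : Matrix m m ℝ := cfc (fun x : ℝ => (√x)⁻¹) S with hR
  have hRsa : star R = R := IsSelfAdjoint.cfc
  have hRSR : R * S * R = 1 := by
    have hid : R * S * R = R * cfc (id : ℝ → ℝ) S * R := by rw [cfc_id ℝ S hsa]
    rw [hid, hR, ← cfc_mul _ _ S (hcont _) (hcont _),
      ← cfc_mul _ _ S (hcont _) (hcont _), ← cfc_one ℝ S hsa]
    refine cfc_congr fun x hx => ?_
    have hx := hspec x hx
    have h1 := Real.mul_self_sqrt hx.le
    have h2 := (Real.sqrt_pos.2 hx).ne'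
    simp only [id, Pi.one_apply]
    field_simp
    nlinarith
  have hcomm : ∀ i, Commute (B i : Matrix m m ℝ) R := by
    intro i
    have hA : star (A i : Matrix m m ℝ) * (A i : Matrix m m ℝ) = 1 :=
      Matrix.UnitaryGroup.star_mul_self (A i)
    have hB : (B i : Matrix m m ℝ) * star (B i : Matrix m m ℝ) = 1 :=
      Unitary.mul_star_self_of_mem (B i).2
    have hinv : star (B i : Matrix m m ℝ) * S * (B i : Matrix m m ℝ) = S := by
      calc star (B i : Matrix m m ℝ) * S * (B i : Matrix m m ℝ)
          = star (T * (B i : Matrix m m ℝ)) * (T * (B i : Matrix m m ℝ)) := by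
            simp only [hS, star_mul, mul_assoc]
        _ = star T * (star (A i : Matrix m m ℝ) * (A i : Matrix m m ℝ)) * T := by
            rw [← h i]; simp only [star_mul, mul_assoc]
        _ = S := by rw [hA, mul_one]
    have hc : Commute S (B i : Matrix m m ℝ) := by
      change S * (B i : Matrix m m ℝ) = (B i : Matrix m m ℝ) * S
      nth_rewrite 2 [← hinv]
      rw [← mul_assoc, ← mul_assoc, hB, one_mul]
    exact (hc.cfc_real _).symm
  have hu : T * R ∈ Matrix.orthogonalGroup m ℝ := by
    rw [Matrix.mem_orthogonalGroup_iff']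
    calc star (T * R) * (T * R) = R * S * R := by
          rw [star_mul, hRsa]; simp only [hS, mul_assoc]
      _ = 1 := hRSR
  refine ⟨⟨T * R, hu⟩, fun i => Subtype.ext ?_⟩
  change (A i : Matrix m m ℝ) * (T * R) = T * R * (B i : Matrix m m ℝ)
  rw [← mul_assoc, h i, mul_assoc, (hcomm i).eq, mul_assoc]

/-- Two orthogonal representations of a finite group are orthogonally conjugate as soon as
their averaged intertwiner is invertible. -/
theorem exists_orthogonal_conj_of_det_ne_zero {G m : Type*} [Group G] [Fintype G]
    [Fintype m] [DecidableEq m] (φ ψ : G →* Matrix.orthogonalGroup m ℝ)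
    (h : (∑ g, (φ g : Matrix m m ℝ) * star (ψ g : Matrix m m ℝ)).det ≠ 0) :
    ∃ u : Matrix.orthogonalGroup m ℝ, ∀ g, φ g * u = u * ψ g := by
  refine exists_orthogonal_intertwiner φ ψ _ h fun g => ?_
  rw [Finset.mul_sum, Finset.sum_mul]
  refine Fintype.sum_equiv (Equiv.mulLeft g) _ _ fun x => ?_
  have hg : star (ψ g : Matrix m m ℝ) * (ψ g : Matrix m m ℝ) = 1 :=
    Matrix.UnitaryGroup.star_mul_self (ψ g)
  simp only [Equiv.coe_mulLeft, map_mul, Submonoid.coe_mul, star_mul, mul_assoc, hg, mul_one]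

/-- A finite group has only countably many orthogonal representations of a given degree, up to
orthogonal conjugation. -/
theorem exists_countable_orthogonal_representatives (G m : Type*) [Group G] [Finite G]
    [Fintype m] [DecidableEq m] :
    ∃ S : Set (G →* Matrix.orthogonalGroup m ℝ), S.Countable ∧
      ∀ φ : G →* Matrix.orthogonalGroup m ℝ, ∃ ψ ∈ S,
        ∃ u : Matrix.orthogonalGroup m ℝ, ∀ g, ψ g = u * φ g * u⁻¹ := by
  cases nonempty_fintype G
  let F : (G →* Matrix.orthogonalGroup m ℝ) → (G → m → m → ℝ) :=
    fun φ g => (φ g : Matrix m m ℝ)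
  let _ : TopologicalSpace (G →* Matrix.orthogonalGroup m ℝ) := .induced F inferInstance
  have : SecondCountableTopology (G →* Matrix.orthogonalGroup m ℝ) :=
    TopologicalSpace.secondCountableTopology_induced _ _ F
  have hF : Continuous F := continuous_induced_dom
  have heval : ∀ g, Continuous fun ψ : G →* Matrix.orthogonalGroup m ℝ =>
      (ψ g : Matrix m m ℝ) := fun g => (continuous_apply g).comp hF
  obtain ⟨S, hSc, hSd⟩ :=
    TopologicalSpace.exists_countable_dense (G →* Matrix.orthogonalGroup m ℝ)
  refine ⟨S, hSc, fun φ => ?_⟩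
  have hcont : Continuous fun ψ : G →* Matrix.orthogonalGroup m ℝ =>
      (∑ g, (ψ g : Matrix m m ℝ) * star (φ g : Matrix m m ℝ)).det :=
    (continuous_finsetSum _ fun g _ => (heval g).matrix_mul continuous_const).matrix_det
  have hφ : (∑ g, (φ g : Matrix m m ℝ) * star (φ g : Matrix m m ℝ)).det ≠ 0 := by
    have h1 : ∀ g, (φ g : Matrix m m ℝ) * star (φ g : Matrix m m ℝ) = 1 :=
      fun g => Unitary.mul_star_self_of_mem (φ g).2
    simp only [h1, Finset.sum_const, Finset.card_univ, ← Nat.cast_smul_eq_nsmul ℝ,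
      Matrix.det_smul, Matrix.det_one, mul_one]
    exact pow_ne_zero _ (Nat.cast_ne_zero.2 Fintype.card_ne_zero)
  obtain ⟨ψ, hψ, hψS⟩ :=
    hSd.inter_open_nonempty _ (isOpen_ne.preimage hcont) ⟨φ, hφ⟩
  obtain ⟨u, hu⟩ := exists_orthogonal_conj_of_det_ne_zero ψ φ hψ
  exact ⟨ψ, hψS, u, fun g => eq_mul_inv_of_mul_eq (hu g)⟩

/-- A finite type carries only finitely many group structures. -/
theorem finite_group_structures (α : Type*) [Finite α] : Finite (Group α) :=
  Finite.of_injective (fun G : Group α => (G.mul : α → α → α)) fun _ _ h => Group.ext h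

/-- A subgroup is the range of a homomorphism out of any type equipotent to it, once that type
is given a suitable group structure. -/
theorem Subgroup.exists_group_range_eq {α M : Type*} [Group M] (H : Subgroup M) (e : α ≃ H) :
    ∃ (_ : Group α) (φ : α →* M), φ.range = H := by
  let _ : Group α := e.group
  refine ⟨_, H.subtype.comp e.mulEquiv.toMonoidHom, ?_⟩
  rw [MonoidHom.range_comp, MonoidHom.range_eq_top.2 (MulEquiv.surjective _),
    ← MonoidHom.range_eq_map, Subgroup.range_subtype]

/-- Up to conjugation, the orthogonal group `O(n, ℝ)` has only countably many finite
subgroups: there is a countable family of subgroups such that every finite subgroup is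
conjugate to a member of the family. -/
theorem countably_many_finite_subgroups_of_orthogonalGroup (n : ℕ) :
    ∃ 𝒮 : Set (Subgroup (Matrix.orthogonalGroup (Fin n) ℝ)),
      𝒮.Countable ∧
      ∀ H : Subgroup (Matrix.orthogonalGroup (Fin n) ℝ),
        (H : Set (Matrix.orthogonalGroup (Fin n) ℝ)).Finite →
        ∃ K ∈ 𝒮, ∃ g : Matrix.orthogonalGroup (Fin n) ℝ,
          K = Subgroup.map (MulAut.conj g).toMonoidHom H := by
  have (k : ℕ) : Finite (Group (Fin k)) := finite_group_structures _
  choose S hSc hS using fun (k : ℕ) (_ : Group (Fin k)) =>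
    exists_countable_orthogonal_representatives (Fin k) (Fin n)
  refine ⟨⋃ (k : ℕ) (G : Group (Fin k)), MonoidHom.range '' S k G,
    Set.countable_iUnion fun k => Set.countable_iUnion fun G => (hSc k G).image _,
    fun H hH => ?_⟩
  have : Finite H := hH
  obtain ⟨G, φ, hφ⟩ := H.exists_group_range_eq (Finite.equivFin H).symm
  obtain ⟨ψ, hψ, u, hu⟩ := hS _ G φ
  refine ⟨ψ.range, Set.mem_iUnion₂.2 ⟨_, G, ψ, hψ, rfl⟩, u, ?_⟩
  have hψφ : ψ = (MulAut.conj u).toMonoidHom.comp φ := MonoidHom.ext hu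
  rw [hψφ, MonoidHom.range_comp, hφ]
end

section
/- The set {0, 1, 2} ⊆ ℝ is not Ramsey; in fact, for every d ∈ ℕ there is a colouring c : EuclideanSpace ℝ (Fin d) → Fin 4 such that there are no points x, y, z ∈ EuclideanSpace ℝ (Fin d) with c(x) = c(y) = c(z), ‖z − x‖ = 2 and y = (x + z)/2. -/
/-- A set `X ⊆ ℝ` is Ramsey if for every `k ≥ 1` there is a dimension `d` such that
every `k`-colouring of `ℝ^d` admits a monochromatic isometric copy of `X`. -/
def IsRamseyRealSubset (X : Set ℝ) : Prop :=
  ∀ k : ℕ, 1 ≤ k → ∃ d : ℕ,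
    ∀ c : EuclideanSpace ℝ (Fin d) → Fin k,
      ∃ f : ℝ → EuclideanSpace ℝ (Fin d),
        (∀ x ∈ X, ∀ y ∈ X, dist (f x) (f y) = dist x y) ∧
        ∃ col : Fin k, ∀ x ∈ X, c (f x) = col

/-- The colouring of a normed space by the residue modulo `4` of `⌊‖u‖²⌋`. -/
noncomputable def normSqColouring {E : Type*} [NormedAddCommGroup E] (u : E) : Fin 4 :=
  ⟨⌊‖u‖ ^ 2⌋₊ % 4, Nat.mod_lt _ (by norm_num)⟩

theorem two_mul_norm_midpoint_sq_add {E : Type*} [NormedAddCommGroup E] [InnerProductSpace ℝ E]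
    (x z : E) :
    2 * ‖midpoint ℝ x z‖ ^ 2 + dist z x ^ 2 / 2 = ‖x‖ ^ 2 + ‖z‖ ^ 2 := by
  have h := parallelogram_law_with_norm ℝ z x
  rw [midpoint_eq_smul_add, norm_smul, dist_eq_norm, add_comm x z, invOf_eq_inv]
  norm_num
  linarith

theorem normSqColouring_midpoint {E : Type*} [NormedAddCommGroup E] [InnerProductSpace ℝ E]
    {x z : E} (hd : dist z x = 2)
    (hx : normSqColouring x = normSqColouring (midpoint ℝ x z)) :
    normSqColouring (midpoint ℝ x z) ≠ normSqColouring z := by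
  intro hz
  have h := two_mul_norm_midpoint_sq_add x z
  rw [hd] at h
  simp only [normSqColouring, Fin.mk.injEq] at hx hz
  generalize midpoint ℝ x z = y at *
  have hx₁ := Nat.floor_le (sq_nonneg ‖x‖)
  have hx₂ := Nat.lt_floor_add_one (‖x‖ ^ 2)
  have hy₁ := Nat.floor_le (sq_nonneg ‖y‖)
  have hy₂ := Nat.lt_floor_add_one (‖y‖ ^ 2)
  have hz₁ := Nat.floor_le (sq_nonneg ‖z‖)
  have hz₂ := Nat.lt_floor_add_one (‖z‖ ^ 2)
  generalize ⌊‖x‖ ^ 2⌋₊ = a at *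
  generalize ⌊‖y‖ ^ 2⌋₊ = b at *
  generalize ⌊‖z‖ ^ 2⌋₊ = c at *
  have h₁ : a + c < 2 * b + 4 := by
    have : (a + c : ℝ) < 2 * b + 4 := by linarith
    exact_mod_cast this
  have h₂ : 2 * b < a + c := by
    have : (2 * b : ℝ) < a + c := by linarith
    exact_mod_cast this
  omega

/-- The set `{0, 1, 2} ⊆ ℝ` is not Ramsey; in fact, in every dimension `d` there is a
`4`-colouring of `ℝ^d` with no monochromatic triple `x, y, z` with `‖z − x‖ = 2` and
`y = (x + z)/2`. -/
theorem zero_one_two_not_ramsey :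
    ¬ IsRamseyRealSubset ({0, 1, 2} : Set ℝ) ∧
    ∀ d : ℕ, ∃ c : EuclideanSpace ℝ (Fin d) → Fin 4,
      ¬ ∃ x y z : EuclideanSpace ℝ (Fin d),
        (c x = c y ∧ c y = c z) ∧ dist z x = 2 ∧ y = midpoint ℝ x z := by
  have key : ∀ d : ℕ, ∃ c : EuclideanSpace ℝ (Fin d) → Fin 4,
      ¬ ∃ x y z : EuclideanSpace ℝ (Fin d),
        (c x = c y ∧ c y = c z) ∧ dist z x = 2 ∧ y = midpoint ℝ x z := by
    refine fun d => ⟨normSqColouring, ?_⟩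
    rintro ⟨x, _, z, ⟨hxy, hyz⟩, hd, rfl⟩
    exact normSqColouring_midpoint hd hxy hyz
  refine ⟨fun hR => ?_, key⟩
  obtain ⟨d, hd⟩ := hR 4 (by norm_num)
  obtain ⟨c, hc⟩ := key d
  obtain ⟨f, hf, col, hcol⟩ := hd c
  have h₀ := hcol 0 (by simp)
  have h₁ := hcol 1 (by simp)
  have h₂ := hcol 2 (by simp)
  have h₀₁ : dist (f 0) (f 1) = 1 := by simp [hf 0 (by simp) 1 (by simp)]
  have h₁₂ : dist (f 1) (f 2) = 1 := by
    rw [hf 1 (by simp) 2 (by simp), Real.dist_eq]; norm_num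
  have h₀₂ : dist (f 0) (f 2) = 2 := by simp [hf 0 (by simp) 2 (by simp)]
  refine hc ⟨f 0, f 1, f 2, ⟨h₀.trans h₁.symm, h₁.trans h₂.symm⟩, by rwa [dist_comm], ?_⟩
  apply eq_midpoint_of_dist_eq_half
  · rw [h₀₁, h₀₂]; norm_num
  · rw [h₁₂, h₀₂]; norm_num
end

section
/- For all positive integers k and r, and for every colouring c : EuclideanSpace ℝ (Fin (k·r)) → Fin k, there exist r + 1 points in EuclideanSpace ℝ (Fin (k·r)), pairwise at distance 1 from one another, on which c is constant. Consequently, the r-dimensional regular simplex with side length 1 is Ramsey. -/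
/-- `ℝⁿ` contains the `n + 1` vertices of a regular simplex of side `1`. -/
theorem exists_pairwise_dist_eq_one (n : ℕ) :
    ∃ p : Fin (n + 1) → EuclideanSpace ℝ (Fin n), ∀ i j, i ≠ j → dist (p i) (p j) = 1 := by
  rcases Nat.eq_zero_or_pos n with rfl | hn
  · exact ⟨0, fun i j h => absurd (Fin.subsingleton_one.elim i j) h⟩
  obtain ⟨a, ha⟩ : ∃ a : ℝ, a ^ 2 = 1 / 2 := ⟨√(1 / 2), Real.sq_sqrt (by norm_num)⟩
  obtain ⟨t, ht⟩ : ∃ t : ℝ, n * t ^ 2 - 2 * (a * t) + a ^ 2 = 1 := by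
    have hn' : (n : ℝ) ≠ 0 := by positivity
    obtain ⟨s, hs⟩ : ∃ s : ℝ, s ^ 2 = a ^ 2 + n / 2 := ⟨_, Real.sq_sqrt (by positivity)⟩
    refine ⟨(a + s) / n, ?_⟩
    field_simp
    linear_combination hs + n * ha
  let q : EuclideanSpace ℝ (Fin n) := WithLp.toLp 2 fun _ => t
  let e : Fin n → EuclideanSpace ℝ (Fin n) := fun i => EuclideanSpace.single i a
  have hq (i : Fin n) : dist q (e i) = 1 := by
    rw [dist_eq_norm, ← sq_eq_sq₀ (norm_nonneg _) zero_le_one, norm_sub_sq_real]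
    simp only [q, e, EuclideanSpace.real_norm_sq_eq, EuclideanSpace.inner_single_right,
      PiLp.single_apply]
    simpa using ht
  have he (i j : Fin n) (hij : i ≠ j) : dist (e i) (e j) = 1 := by
    rw [dist_eq_norm, ← sq_eq_sq₀ (norm_nonneg _) zero_le_one, norm_sub_sq_real]
    simp only [e, EuclideanSpace.inner_single_right, PiLp.norm_single, PiLp.single_apply,
      Real.norm_eq_abs, sq_abs, hij.symm, if_false]
    norm_num [ha]
  refine ⟨Fin.cons q e, fun i j hij => ?_⟩
  cases i using Fin.cases with
  | zero =>
    cases j using Fin.cases with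
    | zero => exact absurd rfl hij
    | succ j => simpa using hq j
  | succ i =>
    cases j using Fin.cases with
    | zero => simpa [dist_comm] using hq i
    | succ j => simpa using he i j (by simpa using hij)

/-- Every `k`-colouring of `ℝ^{kr}` contains the vertices of a monochromatic regular simplex of
dimension `r` and side `1`. -/
theorem exists_monochromatic_pairwise_dist_eq_one (k r : ℕ)
    (c : EuclideanSpace ℝ (Fin (k * r)) → Fin k) :
    ∃ y : Fin (r + 1) → EuclideanSpace ℝ (Fin (k * r)),
      (∀ i j, i ≠ j → dist (y i) (y j) = 1) ∧ ∃ col : Fin k, ∀ i, c (y i) = col := by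
  obtain ⟨p, hp⟩ := exists_pairwise_dist_eq_one (k * r)
  obtain ⟨col, hcol⟩ := Fintype.exists_lt_card_fiber_of_mul_lt_card (n := r) (fun i => c (p i))
    (by simp)
  obtain ⟨g⟩ := Function.Embedding.nonempty_of_card_le (α := Fin (r + 1))
    (β := {i // i ∈ Finset.univ.filter fun i => c (p i) = col})
    (by rw [Fintype.card_fin, Fintype.card_coe]; exact hcol)
  exact ⟨fun i => p (g i), fun i j hij => hp _ _ fun h => hij (g.injective (Subtype.ext h)),
    col, fun i => (Finset.mem_filter.1 (g i).2).2⟩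

/-- Every `k`-colouring of `ℝ^{kr}` contains `r + 1` points, pairwise at distance 1,
on which it is constant; consequently the `r`-dimensional regular unit simplex is
Ramsey. -/
theorem simplex_is_ramsey :
    (∀ k r : ℕ, 0 < k → 0 < r →
      ∀ c : EuclideanSpace ℝ (Fin (k * r)) → Fin k,
        ∃ y : Fin (r + 1) → EuclideanSpace ℝ (Fin (k * r)),
          (∀ i j, i ≠ j → dist (y i) (y j) = 1) ∧
          ∃ col : Fin k, ∀ i, c (y i) = col) ∧
    ∀ r m : ℕ, 0 < r → ∀ x : Fin (r + 1) → EuclideanSpace ℝ (Fin m),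
      (∀ i j, i ≠ j → dist (x i) (x j) = 1) → IsRamsey (Set.range x) := by
  refine ⟨fun k r _ _ c => exists_monochromatic_pairwise_dist_eq_one k r c,
    fun r m _ x hx k _ => ⟨k * r, fun c => ?_⟩⟩
  obtain ⟨y, hy, col, hcol⟩ := exists_monochromatic_pairwise_dist_eq_one k r c
  have hinj : Function.Injective x := fun i j h => by
    by_contra hij
    simpa [h] using hx i j hij
  refine ⟨Function.extend x y 0, ?_, col, ?_⟩
  · rintro _ ⟨i, rfl⟩ _ ⟨j, rfl⟩
    rw [hinj.extend_apply, hinj.extend_apply]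
    rcases eq_or_ne i j with rfl | hij
    · simp
    · rw [hy i j hij, hx i j hij]
  · rintro _ ⟨i, rfl⟩
    rw [hinj.extend_apply, hcol]
end

section
/- Let G be a finite group with more than one element. Then for every n ∈ ℕ and every d ≥ 1 there is a colouring c : G^n → Fin 2 such that there do not exist g = (g_1, …, g_n) ∈ G^n and I ⊆ [n] with |I| = d on which g is constant (g_i = g_j for all i, j ∈ I) and with c constant on the set {g⋄_I h : h ∈ G}. In particular, in the Groups statement one cannot insist that g be constant on I (and hence cannot insist that d = 1). -/
/-- The word `g ⋄_I h`: multiply the entries of `g` indexed by `I` by `h` on the right. -/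
def diamond {G : Type*} [Group G] {n : ℕ} (g : Fin n → G) (I : Finset (Fin n)) (h : G) :
    Fin n → G :=
  fun i => if i ∈ I then g i * h else g i

open Classical in
/-- If `g` takes the value `a` throughout `I`, the identity occurs in `g ⋄_I a⁻¹` at `I.card` more
positions than outside `I`, and in `g ⋄_I h` for `h ≠ a⁻¹` only at positions outside `I`. -/
theorem card_filter_diamond_eq_one {G : Type*} [Group G] {n : ℕ} (g : Fin n → G)
    (I : Finset (Fin n)) (a : G) (hg : ∀ i ∈ I, g i = a) (h : G) :
    (Finset.univ.filter fun i => diamond g I h i = 1).card =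
      (Iᶜ.filter fun i => g i = 1).card + if h = a⁻¹ then I.card else 0 := by
  have hI : (I.filter fun i => diamond g I h i = 1).card = if h = a⁻¹ then I.card else 0 := by
    rw [Finset.filter_congr (q := fun _ => h = a⁻¹) fun i hi => by
      simp [diamond, hi, hg i hi, mul_eq_one_iff_inv_eq, eq_comm]]
    split_ifs with hh <;> simp [hh]
  have hc : (Iᶜ.filter fun i => diamond g I h i = 1) = Iᶜ.filter fun i => g i = 1 :=
    Finset.filter_congr fun i hi => by simp [diamond, Finset.mem_compl.mp hi]
  rw [← hI, ← hc, ← Finset.union_compl I, Finset.filter_union, Finset.card_union_of_disjoint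
    (Finset.disjoint_filter_filter disjoint_compl_right), add_comm]

/-- In the Groups statement (Conjecture 3 of the paper) one cannot insist that the word
`g` be constant on the set `I` (and in particular one cannot insist that `d = 1`):
for every nontrivial finite group `G`, every `n` and every `d ≥ 1` there is a
`2`-colouring of `G^n` admitting no monochromatic set `{g ⋄_I h : h ∈ G}` with `|I| = d`
and `g` constant on `I`. -/
theorem cannot_insist_constant_on_blocks (G : Type*) [Group G] [Fintype G]
    [Nontrivial G] (n d : ℕ) (hd : 1 ≤ d) :
    ∃ c : (Fin n → G) → Fin 2,
      ¬ ∃ (g : Fin n → G) (I : Finset (Fin n)), I.card = d ∧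
        (∀ i ∈ I, ∀ j ∈ I, g i = g j) ∧
        ∃ col : Fin 2, ∀ h : G, c (diamond g I h) = col := by
  classical
  refine ⟨fun v => if ((Finset.univ.filter fun i => v i = 1).card / d) % 2 = 0 then 0 else 1, ?_⟩
  rintro ⟨g, I, hId, hg, col, hcol⟩
  obtain ⟨j, hj⟩ : I.Nonempty := Finset.card_pos.mp (by omega)
  obtain ⟨b, hb⟩ := exists_ne (g j)⁻¹
  have key := (hcol (g j)⁻¹).trans (hcol b).symm
  simp only [card_filter_diamond_eq_one g I (g j) (fun i hi => hg i hi j hj), hId, hb, if_true,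
    if_false, add_zero, Nat.add_div_right _ hd] at key
  split_ifs at key <;> omega
end
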